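/- arXiv:2508.11054 — 11 statements merged into one kernel-verified Lean document; each statement's English description precedes it below -/
import Mathlib

section
/- If a sequence a of non-negative integers is algebraically realizable, i.e. there is a group G and a group endomorphism θ : G → G such that for every n ≥ 1 the set Fix_n(θ) = {x ∈ G : θ^n(x) = x} is finite with exactly a(n) elements, then a can be realized by a group automorphism of a countable locally finite group: there exist a countable group X in which every finitely generated subgroup is finite and a group automorphism σ : X → X such that for every n ≥ 1 the set {x ∈ X : σ^n(x) = x} is finite with exactly a(n) elements. -/
namespace MonoidHom

open Function

variable {G : Type*} [Group G] (θ : G →* G)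

/-- The subgroup of points fixed by the `n`-th iterate of a group endomorphism. -/
def iterateFixedPoints (n : ℕ) : Subgroup G where
  carrier := {x | IsPeriodicPt θ n x}
  mul_mem' {x y} hx hy := by
    change θ^[n] (x * y) = x * y
    rw [iterate_map_mul, hx.eq, hy.eq]
  one_mem' := iterate_map_one θ n
  inv_mem' {x} hx := by
    change θ^[n] x⁻¹ = x⁻¹
    rw [iterate_map_inv, hx.eq]

/-- The subgroup of periodic points of a group endomorphism. -/
def periodicSubgroup : Subgroup G where
  carrier := periodicPts θ
  mul_mem' := by
    rintro x y ⟨m, hm, hx⟩ ⟨n, hn, hy⟩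
    exact ⟨m * n, Nat.mul_pos hm hn,
      (θ.iterateFixedPoints (m * n)).mul_mem (hx.mul_const n) (hy.const_mul m)⟩
  one_mem' := ⟨1, one_pos, (θ.iterateFixedPoints 1).one_mem⟩
  inv_mem' := by
    rintro x ⟨n, hn, hx⟩
    exact ⟨n, hn, (θ.iterateFixedPoints n).inv_mem hx⟩

/-- A group endomorphism restricts to an automorphism of its subgroup of periodic points. -/
noncomputable def periodicAut : θ.periodicSubgroup ≃* θ.periodicSubgroup :=
  MulEquiv.ofBijective
    ((θ.comp θ.periodicSubgroup.subtype).codRestrict θ.periodicSubgroup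
      fun x => (bijOn_periodicPts θ).mapsTo x.2)
    (bijOn_periodicPts θ).bijective

theorem coe_iterate_periodicAut (n : ℕ) (x : θ.periodicSubgroup) :
    ((θ.periodicAut^[n] x : θ.periodicSubgroup) : G) = θ^[n] x :=
  Semiconj.iterate_right (f := ((↑) : θ.periodicSubgroup → G)) (fun _ => rfl) n x

theorem image_coe_fixedPoints_iterate_periodicAut {n : ℕ} (hn : 0 < n) :
    ((↑) : θ.periodicSubgroup → G) '' {x | θ.periodicAut^[n] x = x} = {x | θ^[n] x = x} := by
  ext x
  constructor
  · rintro ⟨y, hy, rfl⟩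
    exact (θ.coe_iterate_periodicAut n y).symm.trans (congrArg _ hy)
  · intro hx
    exact ⟨⟨x, n, hn, hx⟩, Subtype.ext (θ.coe_iterate_periodicAut n _ |>.trans hx), rfl⟩

theorem countable_periodicSubgroup (h : ∀ n, 0 < n → {x | θ^[n] x = x}.Finite) :
    Countable θ.periodicSubgroup := by
  have hc : (⋃ n : {n : ℕ // 0 < n}, {x | θ^[n] x = x}).Countable :=
    Set.countable_iUnion fun n => (h n n.2).countable
  refine (hc.mono ?_).to_subtype
  rintro x ⟨n, hn, hx⟩
  exact Set.mem_iUnion.2 ⟨⟨n, hn⟩, hx⟩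

theorem finite_of_fg_periodicSubgroup (h : ∀ n, 0 < n → {x | θ^[n] x = x}.Finite)
    {H : Subgroup θ.periodicSubgroup} (hH : H.FG) : (H : Set θ.periodicSubgroup).Finite := by
  obtain ⟨S, rfl⟩ := hH
  choose p hp hper using fun x : θ.periodicSubgroup => x.2
  have hpos : 0 < ∏ x ∈ S, p x := Finset.prod_pos fun x _ => hp x
  have hle : Subgroup.closure (S : Set θ.periodicSubgroup) ≤
      (θ.iterateFixedPoints (∏ x ∈ S, p x)).comap θ.periodicSubgroup.subtype :=
    (Subgroup.closure_le _).2 fun x hx => (hper x).trans_dvd (Finset.dvd_prod_of_mem p hx)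
  exact ((h _ hpos).preimage Subtype.val_injective.injOn).subset hle

end MonoidHom

/-- An algebraically realizable sequence can be realized by a group
automorphism of a countable locally finite group. -/
theorem stmt_0 (a : ℕ → ℕ)
    (h : ∃ (G : Type) (_ : Group G) (θ : G →* G),
      ∀ n : ℕ, 1 ≤ n → {x : G | (⇑θ)^[n] x = x}.Finite ∧
        {x : G | (⇑θ)^[n] x = x}.ncard = a n) :
    ∃ (X : Type) (_ : Group X) (σ : X ≃* X),
      Countable X ∧
      (∀ H : Subgroup X, H.FG → (H : Set X).Finite) ∧
      (∀ n : ℕ, 1 ≤ n → {x : X | (⇑σ)^[n] x = x}.Finite ∧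
        {x : X | (⇑σ)^[n] x = x}.ncard = a n) := by
  obtain ⟨G, _, θ, hθ⟩ := h
  have hfin : ∀ n, 0 < n → {x | θ^[n] x = x}.Finite := fun n hn => (hθ n hn).1
  refine ⟨θ.periodicSubgroup, inferInstance, θ.periodicAut, θ.countable_periodicSubgroup hfin,
    fun H hH => θ.finite_of_fg_periodicSubgroup hfin hH, fun n hn => ?_⟩
  have himage := θ.image_coe_fixedPoints_iterate_periodicAut hn
  refine ⟨Set.Finite.of_finite_image (himage ▸ hfin n hn) Subtype.val_injective.injOn, ?_⟩
  rw [← (hθ n hn).2, ← himage, Set.ncard_image_of_injective _ Subtype.val_injective]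
end

section
/- Suppose a bounded sequence a of non-negative integers is algebraically realizable, i.e. there is a group G and a group endomorphism θ : G → G such that for every n ≥ 1 the set {x ∈ G : θ^n(x) = x} is finite with exactly a(n) elements, and suppose m ≥ 1 satisfies a(m) = max{a(n) : n ≥ 1}. Then a can be realized by a group automorphism of a finite group with exactly a(m) elements. -/
open Function in
/-- The subgroup of points fixed by the `n`-th iterate of a group endomorphism. -/
def MonoidHom.periodicSubgroup_s1 {G : Type*} [Group G] (θ : G →* G) (n : ℕ) : Subgroup G where
  carrier := ptsOfPeriod θ n
  mul_mem' {x y} hx hy := by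
    change θ^[n] (x * y) = x * y
    rw [iterate_map_mul, hx.eq, hy.eq]
  one_mem' := iterate_map_one θ n
  inv_mem' {x} hx := by
    change θ^[n] x⁻¹ = x⁻¹
    rw [iterate_map_inv, hx.eq]

/-- A group endomorphism restricts to an automorphism of the points fixed by a positive iterate. -/
def MonoidHom.periodicAut_s1 {G : Type*} [Group G] (θ : G →* G) {n : ℕ} (hn : 1 ≤ n) :
    θ.periodicSubgroup_s1 n ≃* θ.periodicSubgroup_s1 n where
  toFun x := ⟨θ x, Function.IsPeriodicPt.apply (f := θ) x.2⟩
  invFun x := ⟨θ^[n - 1] x, Function.IsPeriodicPt.apply_iterate (f := θ) x.2 _⟩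
  left_inv x := Subtype.ext <| by
    change θ^[n - 1] (θ x) = x
    rw [← Function.iterate_succ_apply, Nat.succ_eq_add_one, Nat.sub_one_add_one (by lia)]
    exact x.2
  right_inv x := Subtype.ext <| by
    change θ (θ^[n - 1] x) = x
    rw [← Function.iterate_succ_apply' θ, Nat.succ_eq_add_one, Nat.sub_one_add_one (by lia)]
    exact x.2
  map_mul' x y := Subtype.ext (map_mul θ (x : G) y)

lemma MonoidHom.coe_iterate_periodicAut_s1 {G : Type*} [Group G] (θ : G →* G) {n : ℕ} (hn : 1 ≤ n)
    (k : ℕ) (x : θ.periodicSubgroup_s1 n) :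
    (((⇑(θ.periodicAut_s1 hn))^[k] x : θ.periodicSubgroup_s1 n) : G) = θ^[k] x :=
  Function.Semiconj.iterate_right (f := Subtype.val) (ga := θ.periodicAut_s1 hn) (gb := θ)
    (fun _ => rfl) k x

/-- If the number of points of period `m` is maximal, then every periodic point has period `m`. -/
lemma Function.ptsOfPeriod_subset_of_ncard_le {α : Type*} {f : α → α} {m : ℕ} (hm : 1 ≤ m)
    (hfin : ∀ n, 1 ≤ n → (ptsOfPeriod f n).Finite)
    (hmax : ∀ n, 1 ≤ n → (ptsOfPeriod f n).ncard ≤ (ptsOfPeriod f m).ncard)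
    {n : ℕ} (hn : 1 ≤ n) : ptsOfPeriod f n ⊆ ptsOfPeriod f m := by
  have hmn : 1 ≤ m * n := Nat.mul_pos hm hn
  have heq : ptsOfPeriod f m = ptsOfPeriod f (m * n) :=
    Set.eq_of_subset_of_ncard_le (fun _ hx => IsPeriodicPt.mul_const hx n) (hmax _ hmn)
      (hfin _ hmn)
  rw [heq]
  exact fun _ hx => IsPeriodicPt.const_mul hx m

/-- A bounded algebraically realizable sequence whose maximum is attained
at `m ≥ 1` can be realized by a group automorphism of a finite group with `a m` elements. -/
theorem stmt_1 (a : ℕ → ℕ) (m : ℕ) (hm : 1 ≤ m)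
    (hmax : ∀ n : ℕ, 1 ≤ n → a n ≤ a m)
    (h : ∃ (G : Type) (_ : Group G) (θ : G →* G),
      ∀ n : ℕ, 1 ≤ n → {x : G | (⇑θ)^[n] x = x}.Finite ∧
        {x : G | (⇑θ)^[n] x = x}.ncard = a n) :
    ∃ (X : Type) (_ : Group X) (σ : X ≃* X),
      Finite X ∧ Nat.card X = a m ∧
      (∀ n : ℕ, 1 ≤ n → {x : X | (⇑σ)^[n] x = x}.Finite ∧
        {x : X | (⇑σ)^[n] x = x}.ncard = a n) := by
  obtain ⟨G, _, θ, hθ⟩ := h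
  have hfinite : Finite (θ.periodicSubgroup_s1 m) := (hθ m hm).1
  refine ⟨θ.periodicSubgroup_s1 m, inferInstance, θ.periodicAut_s1 hm, hfinite, (hθ m hm).2,
    fun n hn => ⟨Set.toFinite _, ?_⟩⟩
  have hsub : {x : G | θ^[n] x = x} ⊆ {x : G | θ^[m] x = x} :=
    Function.ptsOfPeriod_subset_of_ncard_le hm (fun k hk => (hθ k hk).1)
      (fun k hk => (hθ k hk).2.trans_le ((hmax k hk).trans_eq (hθ m hm).2.symm)) hn
  rw [← (hθ n hn).2, ← Set.ncard_image_of_injective _ Subtype.val_injective]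
  congr 1
  ext x
  constructor
  · rintro ⟨y, hy, rfl⟩
    exact (θ.coe_iterate_periodicAut_s1 hm n y).symm.trans (congrArg Subtype.val hy)
  · intro hx
    exact ⟨⟨x, hsub hx⟩, Subtype.ext ((θ.coe_iterate_periodicAut_s1 hm n _).trans hx), rfl⟩
end

section
/- Let p be a prime and let a be a p-sequence, meaning a(n) is a power of p for every n ≥ 1. Suppose a is realized by a group endomorphism θ : G → G of a group G satisfying G = ⋃_{n ≥ 1} Fix_n(θ). Then G is a locally finite p-group: every finitely generated subgroup of G is finite, and every element of G has order a power of p; consequently every finitely generated subgroup of G is nilpotent. -/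
/-- The subgroup of points fixed by the `n`-th iterate of an endomorphism. -/
def MonoidHom.periodicPts {G : Type*} [Group G] (θ : G →* G) (n : ℕ) : Subgroup G where
  carrier := {x : G | (⇑θ)^[n] x = x}
  one_mem' := iterate_map_one θ n
  mul_mem' {x y} hx hy := by
    simp only [Set.mem_ofPred_eq] at hx hy ⊢
    rw [iterate_map_mul, hx, hy]
  inv_mem' {x} hx := by
    simp only [Set.mem_ofPred_eq] at hx ⊢
    rw [iterate_map_inv, hx]

/-- If every point is periodic, then each finitely generated subgroup is fixed pointwise
by some iterate. -/
theorem Subgroup.FG.exists_le_periodicPts {G : Type*} [Group G] {θ : G →* G}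
    (h : ∀ x : G, ∃ n : ℕ, 1 ≤ n ∧ (⇑θ)^[n] x = x) {H : Subgroup G} (hH : H.FG) :
    ∃ n : ℕ, 1 ≤ n ∧ H ≤ θ.periodicPts n := by
  obtain ⟨S, rfl⟩ := hH
  choose n hn hfix using h
  refine ⟨∏ x ∈ S, n x, Nat.one_le_iff_ne_zero.2 (Finset.prod_ne_zero_iff.2 fun x _ =>
    Nat.one_le_iff_ne_zero.1 (hn x)), (Subgroup.closure_le _).2 fun x hx => ?_⟩
  exact Function.IsPeriodicPt.trans_dvd (hfix x) (Finset.dvd_prod_of_mem n hx)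

/-- If a `p`-sequence is realized by an endomorphism `θ` of a group `G` which is
the union of the fixed-point sets of the iterates of `θ`, then `G` is a locally finite
`p`-group, and in particular locally nilpotent. -/
theorem stmt_3 (p : ℕ) (hp : p.Prime) (a : ℕ → ℕ)
    (ha : ∀ n : ℕ, 1 ≤ n → ∃ j : ℕ, a n = p ^ j)
    (G : Type) [Group G] (θ : G →* G)
    (hreal : ∀ n : ℕ, 1 ≤ n → {x : G | (⇑θ)^[n] x = x}.Finite ∧
      {x : G | (⇑θ)^[n] x = x}.ncard = a n)
    (hunion : ∀ x : G, ∃ n : ℕ, 1 ≤ n ∧ (⇑θ)^[n] x = x) :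
    (∀ H : Subgroup G, H.FG → (H : Set G).Finite) ∧
    (∀ x : G, ∃ j : ℕ, orderOf x = p ^ j) ∧
    (∀ H : Subgroup G, H.FG → Group.IsNilpotent H) := by
  have : Fact p.Prime := ⟨hp⟩
  have key : ∀ H : Subgroup G, H.FG → Finite H ∧ IsPGroup p H := by
    intro H hH
    obtain ⟨n, hn, hle⟩ := hH.exists_le_periodicPts hunion
    obtain ⟨hfin, hcard⟩ := hreal n hn
    obtain ⟨j, hj⟩ := ha n hn
    have hP : IsPGroup p (θ.periodicPts n) := IsPGroup.of_card (hcard.trans hj)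
    exact ⟨(hfin.subset hle).to_subtype, hP.to_le hle⟩
  refine ⟨fun H hH => Set.finite_coe_iff.1 (key H hH).1, fun x => ?_, fun H hH => ?_⟩
  · have hx := (key (Subgroup.zpowers x) ⟨{x}, by simp [Subgroup.zpowers_eq_closure]⟩).2
    obtain ⟨j, hj⟩ := IsPGroup.iff_orderOf.1 hx ⟨x, Subgroup.mem_zpowers x⟩
    exact ⟨j, by rw [← hj, Subgroup.orderOf_mk]⟩
  · have := (key H hH).1
    exact (key H hH).2.isNilpotent
end

section
/- Let p be a prime, m ≥ 1 an integer, and q = p^m. Then there exists an m × m integer matrix A such that: (1) for every n ≥ 1 with (q − 1) ∤ n, the determinant det(A^n − I) is not divisible by p; and (2) A^{q−1} = I + pB for some m × m integer matrix B with det(B) not divisible by p. -/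
/-- A nonzero element of a field extension acts with nonzero determinant. -/
theorem Algebra.det_leftMulMatrix_ne_zero {K F ι : Type*} [Field K] [Field F] [Algebra K F]
    [Fintype ι] [DecidableEq ι] (b : Module.Basis ι K F) {c : F} (hc : c ≠ 0) :
    (Algebra.leftMulMatrix b c).det ≠ 0 := by
  have h : Algebra.leftMulMatrix b c * Algebra.leftMulMatrix b c⁻¹ = 1 := by
    rw [← map_mul, mul_inv_cancel₀ hc, map_one]
  intro h0
  have h1 := congrArg Matrix.det h
  rw [Matrix.det_mul, h0, zero_mul, Matrix.det_one] at h1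
  exact zero_ne_one h1

/-- A matrix commuting with multiplication by `g` is itself a multiplication matrix, as soon as
the powers of `g` exhaust the nonzero elements of the field. -/
theorem Algebra.exists_leftMulMatrix_eq_of_commute {K F ι : Type*} [Field K] [Field F]
    [Algebra K F] [Fintype ι] [DecidableEq ι] (b : Module.Basis ι K F) {g : F}
    (hg : ∀ x : F, x ≠ 0 → ∃ k : ℕ, g ^ k = x) {N : Matrix ι ι K}
    (hN : Commute N (Algebra.leftMulMatrix b g)) :
    ∃ c : F, N = Algebra.leftMulMatrix b c := by
  refine ⟨Matrix.toLin b b N 1, ?_⟩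
  apply (Matrix.toLin b b).injective
  rw [Algebra.leftMulMatrix_apply, Matrix.toLin_toMatrix]
  ext x
  rcases eq_or_ne x 0 with rfl | hx
  · simp
  obtain ⟨k, rfl⟩ := hg x hx
  have h := (hN.pow_right k).eq
  rw [← map_pow] at h
  replace h := congrArg (fun T => Matrix.toLin b b T 1) h
  simp only [Matrix.toLin_mul b b b, Algebra.leftMulMatrix_apply, Matrix.toLin_toMatrix,
    LinearMap.comp_apply] at h
  simpa [mul_comm] using h

theorem Int.exists_one_add_pow_eq (a : ℤ) (n : ℕ) :
    ∃ k : ℤ, (1 + a) ^ n = 1 + a * (n + a * k) := by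
  induction n with
  | zero => exact ⟨0, by simp⟩
  | succ n ih =>
    obtain ⟨k, hk⟩ := ih
    exact ⟨k + n + a * k, by rw [pow_succ, hk]; push_cast; ring⟩

/-- An integer matrix reducing to the identity modulo `p` has the form `1 + pB`. -/
theorem Matrix.exists_eq_one_add_smul {ι : Type*} [Fintype ι] [DecidableEq ι] (p : ℕ)
    (A : Matrix ι ι ℤ) (h : (Int.castRingHom (ZMod p)).mapMatrix A = 1) :
    ∃ B : Matrix ι ι ℤ, A = 1 + (p : ℤ) • B := by
  have hd : ∀ i j, (p : ℤ) ∣ A i j - (1 : Matrix ι ι ℤ) i j := by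
    intro i j
    have hij := congrFun (congrFun h i) j
    rw [← ZMod.intCast_zmod_eq_zero_iff_dvd, Int.cast_sub, sub_eq_zero]
    simpa [Matrix.one_apply, apply_ite] using hij
  choose B hB using hd
  refine ⟨Matrix.of B, ?_⟩
  ext i j
  simp only [Matrix.add_apply, Matrix.smul_apply, Matrix.of_apply, smul_eq_mul]
  linarith [hB i j]

/-- For a prime `p`, `m ≥ 1` and `q = p^m` there is an `m × m` integer matrix `A`
with `det(A^n - I)` not divisible by `p` whenever `(q-1) ∤ n`, and `A^(q-1) = I + pB` with
`det B` not divisible by `p`. -/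
theorem stmt_8 (p : ℕ) (hp : p.Prime) (m : ℕ) (hm : 1 ≤ m) :
    ∃ A : Matrix (Fin m) (Fin m) ℤ,
      (∀ n : ℕ, 1 ≤ n → ¬ (p ^ m - 1) ∣ n → ¬ (p : ℤ) ∣ (A ^ n - 1).det) ∧
      ∃ B : Matrix (Fin m) (Fin m) ℤ,
        A ^ (p ^ m - 1) = 1 + (p : ℤ) • B ∧ ¬ (p : ℤ) ∣ B.det := by
  have : Fact p.Prime := ⟨hp⟩
  have hm0 : m ≠ 0 := by omega
  let F := GaloisField p m
  let b : Module.Basis (Fin m) (ZMod p) F :=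
    Module.finBasisOfFinrankEq (ZMod p) F (GaloisField.finrank p hm0)
  let φ := (Int.castRingHom (ZMod p)).mapMatrix (m := Fin m)
  have hdet : ∀ C : Matrix (Fin m) (Fin m) ℤ, (p : ℤ) ∣ C.det ↔ (φ C).det = 0 := by
    intro C
    rw [← RingHom.map_det, eq_intCast, ZMod.intCast_zmod_eq_zero_iff_dvd]
  have hcard : Nat.card Fˣ = p ^ m - 1 := by
    rw [Nat.card_units, GaloisField.card p m hm0]
  obtain ⟨g, hg⟩ := IsCyclic.exists_generator (α := Fˣ)
  have horder : orderOf g = p ^ m - 1 := by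
    rw [orderOf_eq_card_of_forall_mem_zpowers hg, hcard]
  have hpow : ∀ x : F, x ≠ 0 → ∃ k : ℕ, (g : F) ^ k = x := by
    intro x hx
    obtain ⟨k, hk⟩ := (mem_powers_iff_mem_zpowers.2 (hg (Units.mk0 x hx)))
    exact ⟨k, by simpa using congrArg Units.val hk⟩
  have hφsurj : Function.Surjective φ := by
    intro M
    choose f hf using fun i j => ZMod.intCast_surjective (M i j)
    exact ⟨Matrix.of f, by ext i j; simp [φ, hf]⟩
  obtain ⟨A, hA⟩ := hφsurj (Algebra.leftMulMatrix b (g : F))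
  have hnondvd : ∀ A' : Matrix (Fin m) (Fin m) ℤ, φ A' = Algebra.leftMulMatrix b (g : F) →
      ∀ n : ℕ, 1 ≤ n → ¬ (p ^ m - 1) ∣ n → ¬ (p : ℤ) ∣ (A' ^ n - 1).det := by
    intro A' hA' n _ hn
    rw [hdet, map_sub, map_pow, hA', map_one, ← map_pow, ← map_one (Algebra.leftMulMatrix b),
      ← map_sub]
    apply Algebra.det_leftMulMatrix_ne_zero
    rw [sub_ne_zero]
    intro h
    apply hn
    rw [← horder]
    exact orderOf_dvd_of_pow_eq_one (Units.ext (by simpa using h))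
  have hone : φ (A ^ (p ^ m - 1)) = 1 := by
    have h : (g : F) ^ (p ^ m - 1) = 1 := by
      rw [← horder, ← Units.val_pow_eq_pow_val, pow_orderOf_eq_one, Units.val_one]
    rw [map_pow, hA, ← map_pow, h, map_one]
  obtain ⟨B, hB⟩ := Matrix.exists_eq_one_add_smul p _ hone
  have hp0 : (p : ℤ) ≠ 0 := by exact_mod_cast hp.ne_zero
  have hcomm : Commute B A := by
    have h : Commute (A ^ (p ^ m - 1)) A := Commute.pow_self A _
    rw [hB] at h
    have h' := h.eq
    rw [add_mul, mul_add, one_mul, mul_one, add_right_inj, smul_mul_assoc, mul_smul_comm] at h'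
    exact smul_right_injective _ hp0 h'
  obtain ⟨c, hc⟩ := Algebra.exists_leftMulMatrix_eq_of_commute b hpow
    (hA ▸ hcomm.map φ : Commute (φ B) _)
  rcases eq_or_ne c 0 with rfl | hc0
  · rw [map_zero] at hc
    obtain ⟨k, hk⟩ := Int.exists_one_add_pow_eq p (p ^ m - 1)
    set s : ℤ := ((p ^ m - 1 : ℕ) : ℤ) + p * k with hs
    refine ⟨(1 + (p : ℤ)) • A, hnondvd _ ?_, s • (1 : Matrix (Fin m) (Fin m) ℤ) +
      (1 + (p : ℤ) * s) • B, ?_, ?_⟩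
    · rw [map_zsmul, hA, ← Int.cast_smul_eq_zsmul (ZMod p)]
      simp
    · rw [smul_pow, hk, hB]
      module
    · rw [hdet, map_add, map_zsmul, map_zsmul, hc, smul_zero, add_zero, map_one]
      have hs' : (s : ZMod p) = -1 := by
        rw [hs, Nat.cast_sub (Nat.one_le_pow _ _ hp.pos)]
        simp [hm0]
      rw [← Int.cast_smul_eq_zsmul (ZMod p), hs']
      simp [Matrix.det_neg]
  · refine ⟨A, hnondvd A hA, B, hB, ?_⟩
    rw [hdet, hc]
    exact Algebra.det_leftMulMatrix_ne_zero b hc0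
end

section
/- Let p be an odd prime and let k, m ≥ 1 be integers with p ∤ k. Define the sequence ℓ by ℓ(n) = p^{m(1 + ν_p(n))} if k ∣ n, and ℓ(n) = 1 otherwise. Then ℓ is algebraically realizable (i.e. realized by a group endomorphism of some group) if and only if k divides p^m − 1. -/
open Function

/-- The points of exact period `k` under a self-map fall into orbits of size `k`. -/
theorem dvd_ncard_setOf_minimalPeriod_eq {X : Type*} (f : X → X) {k : ℕ} (hk : 0 < k) :
    k ∣ {x | minimalPeriod f x = k}.ncard := by
  rcases Set.finite_or_infinite {x | minimalPeriod f x = k} with hfin | hinf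
  swap
  · simp [hinf.ncard]
  have hmem : ∀ x, minimalPeriod f x = k → minimalPeriod f (f x) = k := fun x hx => by
    rw [minimalPeriod_apply (minimalPeriod_pos_iff_mem_periodicPts.1 (hx ▸ hk)), hx]
  let g : {x | minimalPeriod f x = k} → {x | minimalPeriod f x = k} :=
    fun x => ⟨f x, hmem x x.2⟩
  have hval : ∀ (n : ℕ) x, ((g^[n] x : {x | minimalPeriod f x = k}) : X) = f^[n] x := by
    intro n
    induction n with
    | zero => exact fun _ => rfl
    | succ n ih => exact fun x => by rw [iterate_succ_apply, iterate_succ_apply, ih]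
  have hper : ∀ x, minimalPeriod g x = k := by
    intro x
    have hx : minimalPeriod f (x : X) = k := x.2
    refine Eq.trans (Nat.dvd_antisymm ?_ ?_) hx
    · refine IsPeriodicPt.minimalPeriod_dvd (Subtype.ext ?_)
      rw [hval]
      exact iterate_minimalPeriod
    · refine IsPeriodicPt.minimalPeriod_dvd ?_
      have := congrArg Subtype.val (iterate_minimalPeriod (f := g) (x := x))
      rwa [hval] at this
  have hinv : g^[k] = id := funext fun x =>
    isPeriodicPt_iff_minimalPeriod_dvd.2 (dvd_of_eq (hper x))
  have hk1 : k - 1 + 1 = k := Nat.sub_add_cancel hk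
  let σ : Equiv.Perm {x | minimalPeriod f x = k} :=
    { toFun := g
      invFun := g^[k - 1]
      left_inv := fun x => by rw [← iterate_succ_apply, Nat.succ_eq_add_one, hk1, hinv, id]
      right_inv := fun x => by
        rw [← iterate_succ_apply' g, Nat.succ_eq_add_one, hk1, hinv, id] }
  have := hfin.to_subtype
  have := Fintype.ofFinite {x | minimalPeriod f x = k}
  classical
  rw [← Nat.card_coe_set_eq,
    Nat.card_congr (MulAction.selfEquivSigmaOrbits (Subgroup.zpowers σ) _), Nat.card_sigma]
  refine Finset.dvd_sum fun ω _ => ?_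
  have h := MulAction.minimalPeriod_eq_card σ ω.out
  rw [← Nat.card_eq_fintype_card] at h
  exact dvd_of_eq ((hper _).symm.trans h)

/-- If `x₀` is the only fixed point of `f^[d]` for every `0 < d < k`,
then the other fixed points of `f^[k]` come in orbits of size `k`. -/
theorem dvd_ncard_fixedPoints_sub_one {X : Type*} (f : X → X) (x₀ : X) (h₀ : f x₀ = x₀) {k : ℕ}
    (hk : 0 < k)
    (h : ∀ d, 0 < d → d < k → ∀ x, f^[d] x = x → x = x₀) :
    k ∣ {x | f^[k] x = x}.ncard - 1 := by
  rcases Nat.eq_or_lt_of_le (Nat.succ_le_of_lt hk) with rfl | hk1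
  · exact one_dvd _
  have hmin : minimalPeriod f x₀ = 1 := minimalPeriod_eq_one_iff_isFixedPt.2 h₀
  have hset : {x | minimalPeriod f x = k} = {x | f^[k] x = x} \ {x₀} := by
    ext x
    simp only [Set.mem_ofPred_eq, Set.mem_sdiff, Set.mem_singleton_iff]
    constructor
    · intro hx
      refine ⟨by rw [← hx]; exact iterate_minimalPeriod, ?_⟩
      rintro rfl
      omega
    · rintro ⟨hx, hne⟩
      have hx' : IsPeriodicPt f k x := hx
      refine (hx'.minimalPeriod_le hk).antisymm (not_lt.1 fun hlt => hne ?_)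
      exact h _ (hx'.minimalPeriod_pos hk) hlt x iterate_minimalPeriod
  have hdvd := dvd_ncard_setOf_minimalPeriod_eq f hk
  have hx₀ : x₀ ∈ {x | f^[k] x = x} := iterate_fixed h₀ k
  rwa [hset, Set.ncard_sdiff_singleton_of_mem hx₀] at hdvd

/-- For a domain `R` with fraction field `K`, the `a`-torsion of `K / R` has as many elements as
`R / a R`. -/
theorem natCard_torsion_fractionRing_quotient {R : Type*} [CommRing R] [IsDomain R] {a : R}
    (ha : a ≠ 0) :
    {y : FractionRing R ⧸ LinearMap.range (Algebra.linearMap R (FractionRing R)) |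
      a • y = 0}.ncard = Nat.card (R ⧸ Ideal.span {a}) := by
  set K := FractionRing R
  have ha' : algebraMap R K a ≠ 0 := by simpa using ha
  let φ : R →ₗ[R] K ⧸ LinearMap.range (Algebra.linearMap R K) :=
    (Submodule.mkQ _).comp (LinearMap.toSpanSingleton R K (algebraMap R K a)⁻¹)
  have hφ : ∀ x, φ x = Submodule.Quotient.mk (algebraMap R K x * (algebraMap R K a)⁻¹) :=
    fun x => by simp [φ, Algebra.smul_def]
  have hker : LinearMap.ker φ = Ideal.span {a} := by
    ext x
    rw [LinearMap.mem_ker, hφ, Submodule.Quotient.mk_eq_zero, Ideal.mem_span_singleton']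
    constructor
    · rintro ⟨y, hy⟩
      refine ⟨y, IsFractionRing.injective R K ?_⟩
      rw [Algebra.linearMap_apply] at hy
      rw [map_mul, hy, inv_mul_cancel_right₀ ha']
    · rintro ⟨y, rfl⟩
      exact ⟨y, by rw [Algebra.linearMap_apply, map_mul, mul_inv_cancel_right₀ ha']⟩
  have hrange : (LinearMap.range φ : Set (K ⧸ LinearMap.range (Algebra.linearMap R K))) =
      {y | a • y = 0} := by
    ext y
    obtain ⟨z, rfl⟩ := Submodule.Quotient.mk_surjective _ y
    simp only [SetLike.mem_coe, LinearMap.mem_range, Set.mem_ofPred_eq]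
    constructor
    · rintro ⟨x, hx⟩
      rw [← hx, ← map_smul, smul_eq_mul, ← LinearMap.mem_ker, hker]
      exact Ideal.mul_mem_right _ _ (Ideal.mem_span_singleton_self a)
    · intro h
      rw [← Submodule.Quotient.mk_smul, Submodule.Quotient.mk_eq_zero] at h
      obtain ⟨x, hx⟩ := h
      rw [Algebra.linearMap_apply, Algebra.smul_def] at hx
      exact ⟨x, by rw [hφ, hx, mul_comm (algebraMap R K a), mul_inv_cancel_right₀ ha']⟩
  rw [← hrange, ← Nat.card_coe_set_eq, ← hker]
  exact Nat.card_congr φ.quotKerEquivRange.symm.toEquiv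

/-- The quotient of the Witt vectors of a finite field `F` by `p ^ v` has `|F| ^ v` elements. -/
theorem WittVector.natCard_quotient_span_p_pow (p : ℕ) [Fact p.Prime] (F : Type*) [Field F]
    [Finite F] [CharP F p] (v : ℕ) :
    Nat.card (WittVector p F ⧸ Ideal.span {(p : WittVector p F) ^ v}) = Nat.card F ^ v := by
  have := Fintype.ofFinite F
  have hker : RingHom.ker (WittVector.truncate (p := p) (R := F) v) =
      Ideal.span {(p : WittVector p F) ^ v} := by
    ext x
    rw [WittVector.mem_ker_truncate, WittVector.mem_span_p_pow_iff_le_coeff_eq_zero]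
  rw [← hker, Nat.card_congr (RingHom.quotientKerEquivOfSurjective
    (WittVector.truncate_surjective p v F)).toEquiv, Nat.card_eq_fintype_card,
    TruncatedWittVector.card, Nat.card_eq_fintype_card]

/-- For an odd prime `p`, the number `(1 + p) ^ n - 1` has `p`-adic valuation `1 + ν_p(n)`. -/
theorem exists_one_add_pow_eq {p n : ℕ} (hp : p.Prime) (hp2 : p ≠ 2) (hn : n ≠ 0) :
    ∃ c, ¬ p ∣ c ∧ (1 + p) ^ n = 1 + p ^ (1 + padicValNat p n) * c := by
  have := Fact.mk hp
  have hv := padicValNat.pow_sub_pow (p := p) (x := 1 + p) (y := 1)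
    (hp.eq_two_or_odd'.resolve_left hp2) (by have := hp.pos; omega) (by simp)
    (by simpa [Nat.dvd_add_left] using hp.one_lt.ne') hn
  simp only [one_pow, Nat.add_sub_cancel_left, padicValNat_self] at hv
  have hpos : 1 < (1 + p) ^ n := Nat.one_lt_pow hn (by have := hp.pos; omega)
  obtain ⟨c, hc⟩ := pow_padicValNat_dvd (p := p) (n := (1 + p) ^ n - 1)
  refine ⟨c, fun ⟨d, hd⟩ => ?_, by rw [← hv, ← hc]; omega⟩
  refine pow_succ_padicValNat_not_dvd (p := p) (n := (1 + p) ^ n - 1) (by omega) ⟨d, ?_⟩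
  rw [pow_succ, mul_assoc, ← hd]
  exact hc

/-- Multiplication by the unit `[ζ] (1 + p)` of `W(F)`, where `ζ ∈ F` has order `k`, acts on
`Frac W(F) / W(F)` with the prescribed numbers of periodic points. -/
theorem ncard_fixedPoints_teichmuller_mul (p : ℕ) [Fact p.Prime] (hp2 : p ≠ 2) (F : Type*)
    [Field F] [Finite F] [CharP F p] (ζ : F) {n : ℕ} (hn : n ≠ 0) :
    {y : FractionRing (WittVector p F) ⧸
        LinearMap.range (Algebra.linearMap (WittVector p F) (FractionRing (WittVector p F))) |
      (WittVector.teichmuller p ζ * (1 + p)) ^ n • y = y}.ncard =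
      if orderOf ζ ∣ n then Nat.card F ^ (1 + padicValNat p n) else 1 := by
  have hp : p.Prime := Fact.out
  set u : WittVector p F := WittVector.teichmuller p ζ * (1 + p) with hu
  suffices h : ∃ b : WittVector p F, IsUnit b ∧ u ^ n - 1 = (p : WittVector p F) ^
      (if orderOf ζ ∣ n then 1 + padicValNat p n else 0) * b by
    obtain ⟨b, hb, h⟩ := h
    have hne : u ^ n - 1 ≠ 0 := by
      rw [h]
      exact mul_ne_zero (pow_ne_zero _ (WittVector.p_nonzero p F)) hb.ne_zero
    have hset := natCard_torsion_fractionRing_quotient hne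
    simp only [sub_smul, one_smul, sub_eq_zero] at hset
    rw [hset, h, Ideal.span_singleton_mul_right_unit hb,
      WittVector.natCard_quotient_span_p_pow]
    split_ifs <;> simp
  have hcoeff : ∀ x : WittVector p F, WittVector.constantCoeff x ≠ 0 → IsUnit x :=
    WittVector.isUnit_of_coeff_zero_ne_zero
  split_ifs with hdvd
  · obtain ⟨c, hc, hpow⟩ := exists_one_add_pow_eq hp hp2 hn
    refine ⟨c, hcoeff _ ?_, ?_⟩
    · rwa [map_natCast, Ne, CharP.cast_eq_zero_iff F p]
    · have hpow' := congrArg (Nat.cast : ℕ → WittVector p F) hpow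
      push_cast at hpow'
      rw [hu, mul_pow, ← map_pow, orderOf_dvd_iff_pow_eq_one.1 hdvd, map_one, one_mul, hpow',
        add_sub_cancel_left]
  · refine ⟨u ^ n - 1, hcoeff _ ?_, by simp⟩
    have hζ : WittVector.constantCoeff (WittVector.teichmuller p ζ) = ζ :=
      WittVector.teichmuller_coeff_zero p ζ
    rw [hu, map_sub, map_pow, map_mul, hζ, map_add, map_one, map_natCast, CharP.cast_eq_zero,
      add_zero, mul_one, Ne, sub_eq_zero]
    exact fun h => hdvd (orderOf_dvd_of_pow_eq_one h)

/-- For an odd prime `p` and `k, m ≥ 1` with `p ∤ k`, the sequence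
`ℓ(n) = p^(m(1 + ν_p(n)))` if `k ∣ n` and `ℓ(n) = 1` otherwise is algebraically realizable
if and only if `k ∣ p^m - 1`. -/
theorem stmt_9 (p k m : ℕ) (hp : p.Prime) (hp2 : p ≠ 2)
    (hk : 1 ≤ k) (hm : 1 ≤ m) (hpk : ¬ p ∣ k) :
    (∃ (G : Type) (_ : Group G) (θ : G →* G),
      ∀ n : ℕ, 1 ≤ n → {x : G | (⇑θ)^[n] x = x}.Finite ∧
        {x : G | (⇑θ)^[n] x = x}.ncard =
          (if k ∣ n then p ^ (m * (1 + padicValNat p n)) else 1)) ↔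
    k ∣ p ^ m - 1 := by
  have := Fact.mk hp
  constructor
  · rintro ⟨G, _, θ, h⟩
    have hdvd := dvd_ncard_fixedPoints_sub_one θ 1 (map_one θ) hk fun d hd hdk x hx => by
      have hcard := (h d hd).2
      rw [if_neg (Nat.not_dvd_of_pos_of_lt hd hdk)] at hcard
      obtain ⟨y, hy⟩ := Set.ncard_eq_one.1 hcard
      have h1 : x = y := hy.subset hx
      have h2 : (1 : G) = y := hy.subset (iterate_fixed (map_one θ) d)
      exact h1.trans h2.symm
    rwa [(h k hk).2, if_pos dvd_rfl, padicValNat.eq_zero_of_not_dvd hpk, add_zero, mul_one]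
      at hdvd
  · intro hdvd
    let F := GaloisField p m
    have hF : Nat.card F = p ^ m := GaloisField.card p m (by omega)
    have := Fintype.ofFinite F
    obtain ⟨g, hg⟩ := IsCyclic.exists_ofOrder_eq_natCard (α := Fˣ)
    have hg' : orderOf g = p ^ m - 1 := by rw [hg, Nat.card_units, hF]
    have hpm : p ^ m - 1 ≠ 0 := by
      have := Nat.one_lt_pow (show m ≠ 0 by omega) hp.one_lt
      omega
    obtain ⟨l, hl⟩ := hdvd
    have hl0 : l ≠ 0 := by rintro rfl; exact hpm (by simpa using hl)
    let ζ : F := ((g ^ l : Fˣ) : F)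
    have hζ : orderOf ζ = k := by
      rw [orderOf_units, orderOf_pow_of_dvd hl0 (by rw [hg', hl]; exact dvd_mul_left _ _), hg', hl,
        Nat.mul_div_cancel _ (Nat.pos_of_ne_zero hl0)]
    let W := WittVector p F
    let M := FractionRing W ⧸ LinearMap.range (Algebra.linearMap W (FractionRing W))
    let u : W := WittVector.teichmuller p ζ * (1 + p)
    let θ : M →+ M := DistribSMul.toAddMonoidHom M u
    refine ⟨Multiplicative M, inferInstance, AddMonoidHom.toMultiplicative θ, fun n hn => ?_⟩
    have hiter : ∀ x : M, θ^[n] x = u ^ n • x := fun x => smul_iterate_apply u n x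
    have hcard : {x : M | θ^[n] x = x}.ncard =
        if k ∣ n then p ^ (m * (1 + padicValNat p n)) else 1 := by
      simp only [hiter]
      rw [ncard_fixedPoints_teichmuller_mul p hp2 F ζ (by omega), hζ, hF, ← pow_mul]
    refine ⟨Set.finite_of_ncard_ne_zero (s := {x : M | θ^[n] x = x}) ?_, hcard⟩
    rw [hcard]
    split_ifs
    · exact pow_ne_zero _ hp.ne_zero
    · exact one_ne_zero
end

section
/- The sequence n ↦ 2^{2 + ν_2(n)} (for n ≥ 1) is algebraically realizable: there exist a group G and a group endomorphism θ : G → G such that for every n ≥ 1 the set {x ∈ G : θ^n(x) = x} is finite with exactly 2^{2 + ν_2(n)} elements. (It is realized by multiplication by 5 on the additive torsion group ℤ[1/2]/ℤ.) -/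
theorem two_pow_dvd_five_pow_sub_one_iff {n : ℕ} (hn : n ≠ 0) (j : ℕ) :
    2 ^ j ∣ 5 ^ n - 1 ↔ j ≤ 2 + padicValNat 2 n := by
  have h : emultiplicity 2 (5 ^ n - 1) = ((2 + padicValNat 2 n : ℕ) : ℕ∞) := by
    have h4 : emultiplicity (2 : ℤ) (5 - 1) = 2 := by
      rw [show (5 - 1 : ℤ) = 2 ^ 2 by norm_num,
        emultiplicity_pow_self_of_prime Int.prime_two]
      rfl
    have key := Int.two_pow_sub_pow' (x := 5) (y := 1) n (by norm_num) (by norm_num)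
    rw [h4, one_pow] at key
    rw [← Int.natCast_emultiplicity, Nat.cast_sub (Nat.one_le_pow _ _ (by norm_num)),
      Nat.cast_add, padicValNat_eq_emultiplicity hn, ← Int.natCast_emultiplicity]
    exact_mod_cast key
  rw [pow_dvd_iff_le_emultiplicity, h, Nat.cast_le]

theorem pow_five_pow_eq_self_iff {M : Type*} [Group M] {x : M} {j n : ℕ}
    (hx : orderOf x = 2 ^ j) (hn : n ≠ 0) :
    x ^ 5 ^ n = x ↔ x ^ 2 ^ (2 + padicValNat 2 n) = 1 := by
  have h : x ^ 5 ^ n = x ↔ x ^ (5 ^ n - 1) = 1 := by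
    rw [pow_sub _ (Nat.one_le_pow _ _ (by norm_num)), pow_one, mul_inv_eq_one]
  rw [h, ← orderOf_dvd_iff_pow_eq_one, ← orderOf_dvd_iff_pow_eq_one, hx,
    two_pow_dvd_five_pow_sub_one_iff hn, Nat.pow_dvd_pow_iff_le_right (by norm_num)]

/-- The sequence `n ↦ 2^(2 + ν₂(n))` is algebraically realizable. -/
theorem stmt_10 :
    ∃ (G : Type) (_ : Group G) (θ : G →* G),
      ∀ n : ℕ, 1 ≤ n → {x : G | (⇑θ)^[n] x = x}.Finite ∧
        {x : G | (⇑θ)^[n] x = x}.ncard = 2 ^ (2 + padicValNat 2 n) := by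
  refine ⟨CommGroup.primaryComponent ℂˣ 2, inferInstance, powMonoidHom 5, fun n hn ↦ ?_⟩
  have himage : Subtype.val '' {x : CommGroup.primaryComponent ℂˣ 2 |
      (⇑(powMonoidHom 5 : CommGroup.primaryComponent ℂˣ 2 →* _))^[n] x = x} =
      (rootsOfUnity (2 ^ (2 + padicValNat 2 n)) ℂ : Set ℂˣ) := by
    ext u
    have hiter (x : CommGroup.primaryComponent ℂˣ 2) :
        (⇑(powMonoidHom 5 : CommGroup.primaryComponent ℂˣ 2 →* _))^[n] x = x ↔
          (x : ℂˣ) ^ 5 ^ n = x := by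
      rw [show ⇑(powMonoidHom 5 : CommGroup.primaryComponent ℂˣ 2 →* _) = (· ^ 5) from rfl,
        pow_iterate, Subtype.ext_iff, Subgroup.coe_pow]
    simp only [Set.mem_image, Set.mem_ofPred_eq, hiter, SetLike.mem_coe, mem_rootsOfUnity]
    constructor
    · rintro ⟨x, hx, rfl⟩
      obtain ⟨j, hj⟩ := CommGroup.mem_primaryComponent_iff_orderOf.1 x.2
      exact (pow_five_pow_eq_self_iff hj (by lia)).1 hx
    · intro hu
      obtain ⟨j, -, hj⟩ := (Nat.dvd_prime_pow Nat.prime_two).1 (orderOf_dvd_of_pow_eq_one hu)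
      exact ⟨⟨u, CommGroup.mem_primaryComponent_iff_orderOf.2 ⟨j, hj⟩⟩,
        (pow_five_pow_eq_self_iff hj (by lia)).2 hu, rfl⟩
  have hcard : {x : CommGroup.primaryComponent ℂˣ 2 |
      (⇑(powMonoidHom 5 : CommGroup.primaryComponent ℂˣ 2 →* _))^[n] x = x}.ncard =
      2 ^ (2 + padicValNat 2 n) := by
    rw [← Set.ncard_image_of_injective _ Subtype.val_injective, himage]
    exact Complex.card_rootsOfUnity _
  exact ⟨Set.finite_of_ncard_ne_zero (by rw [hcard]; positivity), hcard⟩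
end

section
/- Let b(n) denote the denominator of the rational number B_{2n}/(2n) in lowest terms. Then for every prime q, the sequence n ↦ q^{ν_q(b(n))} of q-parts of b is algebraically realizable: there exist a group G and a group endomorphism θ : G → G such that for every n ≥ 1 the set {x ∈ G : θ^n(x) = x} is finite with exactly q^{ν_q(b(n))} elements. -/
/-- If `D * x` is an integer prime to `q`, then `D` and the denominator of `x` have the same
`q`-adic valuation. -/
theorem padicValNat_den_eq_of_mul_eq {q : ℕ} [Fact q.Prime] {x : ℚ} {D : ℕ} {u : ℤ}
    (hD : D ≠ 0) (h : (D : ℚ) * x = u) (hu : ¬ (q : ℤ) ∣ u) :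
    padicValNat q x.den = padicValNat q D := by
  have hden : (x.den : ℚ) ≠ 0 := by exact_mod_cast x.den_nz
  have h1 : (D : ℤ) * x.num = u * x.den := by
    have h2 : (D : ℚ) * x.num = u * x.den := by
      rw [← h, mul_assoc, Rat.mul_den_eq_num]
    exact_mod_cast h2
  have h3 : D * x.num.natAbs = u.natAbs * x.den := by
    simpa [Int.natAbs_mul] using congrArg Int.natAbs h1
  have hu' : ¬ q ∣ u.natAbs := fun h' => hu (Int.natCast_dvd.mpr h')
  have hu0 : u.natAbs ≠ 0 := fun h' => hu' (h' ▸ dvd_zero q)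
  have hn0 : x.num.natAbs ≠ 0 := by
    intro h'
    rw [h', mul_zero] at h3
    exact mul_ne_zero hu0 x.den_nz h3.symm
  have hle : padicValNat q x.den ≤ padicValNat q D :=
    padicValNat_dvd_iff_le hD |>.mp (pow_padicValNat_dvd.trans
      (x.reduced.symm.dvd_of_dvd_mul_right (h3 ▸ dvd_mul_left _ _)))
  have h4 := congrArg (padicValNat q) h3
  rw [padicValNat.mul hD hn0, padicValNat.mul hu0 x.den_nz,
    padicValNat.eq_zero_of_not_dvd hu'] at h4
  omega

theorem padicValNat_den_eq_zero_of_mul_eq {q : ℕ} {x : ℚ} {d u : ℤ}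
    (h : (d : ℚ) * x = u) (hd : ¬ (q : ℤ) ∣ d) : padicValNat q x.den = 0 := by
  refine padicValNat.eq_zero_of_not_dvd fun hq => hd ?_
  have h1 : d * x.num = u * x.den := by
    have h2 : (d : ℚ) * x.num = u * x.den := by
      rw [← h, mul_assoc, Rat.mul_den_eq_num]
    exact_mod_cast h2
  have h3 : (x.den : ℤ) ∣ d :=
    (Int.isCoprime_iff_gcd_eq_one (m := x.num) (n := x.den) |>.mpr x.reduced).symm.dvd_of_dvd_mul_right
      (Dvd.intro_left u h1.symm)
  exact (Int.natCast_dvd_natCast.mpr hq).trans h3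

/-- Multiplication by a unit permutes residues, hence preserves sums over them. -/
theorem sum_range_mul_mod {M : Type*} [AddCommMonoid M] (f : ℕ → M) {a N : ℕ} (hN : 0 < N)
    (h : a.Coprime N) :
    ∑ j ∈ Finset.range N, f (j * a % N) = ∑ j ∈ Finset.range N, f j := by
  have hinj : Set.InjOn (fun j => j * a % N) (Finset.range N) := by
    intro i hi j hj hij
    have := Nat.ModEq.cancel_right_of_coprime (Nat.coprime_comm.mp h) hij
    exact Nat.ModEq.eq_of_lt_of_lt this (Finset.mem_range.mp hi) (Finset.mem_range.mp hj)
  have himg : (Finset.range N).image (fun j => j * a % N) = Finset.range N := by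
    refine Finset.eq_of_subset_of_card_le (fun x hx => ?_)
      (Finset.card_image_of_injOn hinj).ge
    obtain ⟨j, -, rfl⟩ := Finset.mem_image.mp hx
    exact Finset.mem_range.mpr (Nat.mod_lt _ hN)
  conv_rhs => rw [← himg, Finset.sum_image hinj]

/-- A form of Voronoi's congruence for power sums. -/
theorem exists_pow_sub_one_mul_sum_range_pow_eq (k : ℕ) {a N : ℕ} (hN : 0 < N)
    (h : a.Coprime N) :
    ∃ z w : ℤ, ((a : ℤ) ^ k - 1) * ∑ j ∈ Finset.range N, (j : ℤ) ^ k =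
      k * N * z + N ^ 2 * w := by
  have key : ∀ j : ℕ, ∃ z w : ℤ,
      (a : ℤ) ^ k * (j : ℤ) ^ k = ((j * a % N : ℕ) : ℤ) ^ k + k * N * z + N ^ 2 * w := by
    intro j
    obtain ⟨c, hc⟩ := Polynomial.powAddExpansion ((j * a % N : ℕ) : ℤ)
      ((N * (j * a / N) : ℕ) : ℤ) k
    refine ⟨((j * a % N : ℕ) : ℤ) ^ (k - 1) * (j * a / N : ℕ), c * (j * a / N : ℕ) ^ 2, ?_⟩
    have h1 : ((j * a % N : ℕ) : ℤ) + ((N * (j * a / N) : ℕ) : ℤ) = j * a := by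
      exact_mod_cast Nat.mod_add_div (j * a) N
    rw [h1] at hc
    rw [← mul_pow, mul_comm (a : ℤ), hc, Nat.cast_mul N]
    ring
  choose z w hzw using key
  refine ⟨∑ j ∈ Finset.range N, z j, ∑ j ∈ Finset.range N, w j, ?_⟩
  rw [sub_mul, one_mul, Finset.mul_sum, Finset.sum_congr rfl fun j _ => hzw j,
    Finset.sum_add_distrib, Finset.sum_add_distrib,
    sum_range_mul_mod (fun j => (j : ℤ) ^ k) hN h, Finset.mul_sum, Finset.mul_sum]
  ring

/-- The power sum over `range N` is `N * B_k` modulo `N ^ 2`, up to a denominator independent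
of `N`. -/
theorem exists_mul_sum_range_pow_sub_eq (k : ℕ) :
    ∃ D : ℕ, D ≠ 0 ∧ ∀ N : ℕ, ∃ E : ℤ,
      (D : ℚ) * (∑ j ∈ Finset.range N, (j : ℚ) ^ k - N * bernoulli k) = N ^ 2 * E := by
  refine ⟨(k + 1) * ∏ i ∈ Finset.range k, (bernoulli i).den,
    mul_ne_zero k.succ_ne_zero (Finset.prod_ne_zero_iff.mpr fun i _ => (bernoulli i).den_nz),
    fun N => ?_⟩
  have hint : ∀ i ∈ Finset.range k, ∃ e : ℤ,
      ((∏ i ∈ Finset.range k, (bernoulli i).den : ℕ) : ℚ) * bernoulli i = e := by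
    intro i hi
    obtain ⟨c, hc⟩ := Finset.dvd_prod_of_mem (fun i => (bernoulli i).den) hi
    refine ⟨c * (bernoulli i).num, ?_⟩
    rw [hc]
    push_cast
    rw [← Rat.mul_den_eq_num]
    ring
  choose! e he using hint
  refine ⟨∑ i ∈ Finset.range k, e i * (k + 1).choose i * N ^ (k - 1 - i), ?_⟩
  have hk : (k : ℚ) + 1 ≠ 0 := by positivity
  rw [sum_range_pow, Finset.sum_range_succ]
  have hlast : bernoulli k * ((k + 1).choose k : ℚ) * (N : ℚ) ^ (k + 1 - k) / (k + 1) =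
      N * bernoulli k := by
    rw [Nat.choose_succ_self_right, Nat.add_sub_cancel_left]
    push_cast
    field_simp
  rw [hlast, add_sub_cancel_right, Finset.mul_sum]
  push_cast
  rw [Finset.mul_sum]
  refine Finset.sum_congr rfl fun i hi => ?_
  rw [← he i hi]
  have hpow : (N : ℚ) ^ (k + 1 - i) = N ^ 2 * N ^ (k - 1 - i) := by
    rw [← pow_add]
    congr 1
    have := Finset.mem_range.mp hi
    omega
  rw [hpow]
  push_cast
  field_simp

/-- Adams' theorem: `B_k / k` is `q`-integral as soon as some `a` prime to `q` satisfies
`a ^ k ≢ 1 [MOD q]`. -/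
theorem padicValNat_den_bernoulli_div_eq_zero {q : ℕ} (hq : q.Prime) {k a : ℕ} (hk : k ≠ 0)
    (ha : ¬ q ∣ a) (hak : ¬ (q : ℤ) ∣ (a : ℤ) ^ k - 1) :
    padicValNat q (bernoulli k / k).den = 0 := by
  obtain ⟨D, hD, hS⟩ := exists_mul_sum_range_pow_sub_eq k
  obtain ⟨s, m, hm, hDk⟩ := Nat.exists_eq_pow_mul_and_not_dvd (mul_ne_zero hD hk) q hq.ne_one
  have hN : 0 < q ^ s := pow_pos hq.pos s
  obtain ⟨E, hE⟩ := hS (q ^ s)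
  obtain ⟨z, w, hzw⟩ := exists_pow_sub_one_mul_sum_range_pow_eq k hN
    (Nat.Coprime.pow_right s ((Nat.Prime.coprime_iff_not_dvd hq).mpr ha).symm)
  refine padicValNat_den_eq_zero_of_mul_eq (d := m * ((a : ℤ) ^ k - 1))
    (u := m * z + D * w - E * ((a : ℤ) ^ k - 1)) ?_ ?_
  · have hNQ : ((q ^ s : ℕ) : ℚ) ≠ 0 := by exact_mod_cast hN.ne'
    have hkQ : (k : ℚ) ≠ 0 := by exact_mod_cast hk
    have hDQ : (D : ℚ) ≠ 0 := by exact_mod_cast hD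
    have hDkQ : (D : ℚ) * k = (q ^ s : ℕ) * m := by exact_mod_cast hDk
    have hzwQ : ((a : ℚ) ^ k - 1) * ∑ j ∈ Finset.range (q ^ s), (j : ℚ) ^ k =
        k * (q ^ s : ℕ) * z + (q ^ s : ℕ) ^ 2 * w := by exact_mod_cast hzw
    generalize ((q ^ s : ℕ) : ℚ) = N at *
    generalize ∑ j ∈ Finset.range (q ^ s), (j : ℚ) ^ k = S at *
    push_cast
    generalize (a : ℚ) ^ k - 1 = A at *
    have hmain : N * (k * (m * A * (bernoulli k / k))) =
        N * (k * (m * z + D * w - E * A)) := by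
      have e1 : (k : ℚ) * (m * A * (bernoulli k / k)) = m * A * bernoulli k := by field_simp
      rw [e1]
      refine mul_left_cancel₀ hDQ ?_
      linear_combination (-m * A) * hE + (D * m) * hzwQ - (N * D * w - N * A * E) * hDkQ
    exact mul_left_cancel₀ hkQ (mul_left_cancel₀ hNQ hmain)
  · intro h
    rcases (Nat.prime_iff_prime_int.mp hq).dvd_or_dvd h with h | h
    · exact hm (Int.natCast_dvd_natCast.mp h)
    · exact hak h

/-- The `q`-adic valuation of the denominator of `B_{2n} / (2n)` when `q - 1` divides `2n`. -/
theorem padicValNat_den_bernoulli_div_of_dvd {q : ℕ} (hq : q.Prime) {n : ℕ} (hn : n ≠ 0)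
    (hd : q - 1 ∣ 2 * n) :
    padicValNat q (bernoulli (2 * n) / (2 * n : ℚ)).den = 1 + padicValNat q (2 * n) := by
  have := Fact.mk hq
  obtain ⟨T, hT⟩ := Bernoulli.vonStaudt_clausen n
  set s := (Finset.range (2 * n + 2)).filter fun p => p.Prime ∧ (p - 1) ∣ 2 * n with hs
  have hqs : q ∈ s := by
    have := Nat.le_of_dvd (by omega) hd
    exact Finset.mem_filter.mpr ⟨Finset.mem_range.mpr (by omega), hq, hd⟩
  rw [← Finset.add_sum_erase s _ hqs] at hT
  set P : ℕ := ∏ p ∈ s.erase q, p with hP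
  have hprime : ∀ p ∈ s.erase q, p.Prime := fun p hp =>
    (Finset.mem_filter.mp (Finset.mem_of_mem_erase hp)).2.1
  have hqP : ¬ q ∣ P := by
    intro h
    obtain ⟨p, hp, hqp⟩ := (Nat.prime_iff.mp hq).exists_mem_finset_dvd h
    exact Finset.ne_of_mem_erase hp ((Nat.prime_dvd_prime_iff_eq hq (hprime p hp)).mp hqp).symm
  have hP0 : P ≠ 0 := fun h => hqP (h ▸ dvd_zero q)
  obtain ⟨c, hc⟩ : ∃ c : ℤ, (P : ℚ) * ∑ p ∈ s.erase q, (1 : ℚ) / p = c := by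
    refine ⟨∑ p ∈ s.erase q, ((P / p : ℕ) : ℤ), ?_⟩
    rw [Finset.mul_sum, Int.cast_sum]
    refine Finset.sum_congr rfl fun p hp => ?_
    rw [Int.cast_natCast, Nat.cast_div (Finset.dvd_prod_of_mem (fun p => p) hp) (by exact_mod_cast (hprime p hp).ne_zero)]
    ring
  have hqQ : (q : ℚ) ≠ 0 := by exact_mod_cast hq.ne_zero
  have hnQ : (n : ℚ) ≠ 0 := by exact_mod_cast hn
  rw [padicValNat_den_eq_of_mul_eq (D := q * P * (2 * n)) (u := q * P * T - P - q * c)]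
  · rw [padicValNat.mul (mul_ne_zero hq.ne_zero hP0) (by omega),
      padicValNat.mul hq.ne_zero hP0, padicValNat.eq_zero_of_not_dvd hqP,
      padicValNat.self hq.one_lt, add_zero]
  · exact mul_ne_zero (mul_ne_zero hq.ne_zero hP0) (by omega)
  · push_cast
    rw [← hc, hT]
    field_simp
    ring
  · intro h
    have h2 : (q : ℤ) ∣ P := by
      have h3 : (P : ℤ) = q * (P * T - c) - (q * P * T - P - q * c) := by ring
      rw [h3]
      exact dvd_sub (dvd_mul_right _ _) h
    exact hqP (Int.natCast_dvd_natCast.mp h2)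

/-- A primitive root modulo `q ^ 2` has the expected valuations of `h ^ k - 1`. -/
theorem exists_padicValNat_pow_sub_one {q : ℕ} (hq : q.Prime) (hq2 : q ≠ 2) :
    ∃ h : ℕ, 1 < h ∧ ¬ q ∣ h ∧ (∀ k, q ∣ h ^ k - 1 → q - 1 ∣ k) ∧
      ∀ k, k ≠ 0 → q - 1 ∣ k → padicValNat q (h ^ k - 1) = 1 + padicValNat q k := by
  have := Fact.mk hq
  have hq1 := hq.one_lt
  have : NeZero (q ^ 2) := ⟨pow_ne_zero 2 hq.ne_zero⟩
  have := ZMod.isCyclic_units_of_prime_pow q hq hq2 2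
  obtain ⟨u, hu⟩ := IsCyclic.exists_generator (α := (ZMod (q ^ 2))ˣ)
  have hord : orderOf u = q * (q - 1) := by
    rw [orderOf_eq_card_of_forall_mem_zpowers hu, Nat.card_eq_fintype_card,
      ZMod.card_units_eq_totient, Nat.totient_prime_pow hq (by norm_num)]
    simp
  set h := (u : ZMod (q ^ 2)).val with hh
  have hcast : (h : ZMod (q ^ 2)) = u := ZMod.natCast_zmod_val _
  have hcop : h.Coprime (q ^ 2) := ZMod.val_coe_unit_coprime u
  have hqh : ¬ q ∣ h := (Nat.Prime.coprime_iff_not_dvd hq).mp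
    (Nat.Coprime.coprime_dvd_right (dvd_pow_self q two_ne_zero) hcop).symm
  have hpos : 0 < h := Nat.pos_of_ne_zero fun h0 => hqh (h0 ▸ dvd_zero q)
  have hsq : ∀ k, q ^ 2 ∣ h ^ k - 1 ↔ q * (q - 1) ∣ k := by
    intro k
    rw [← hord, orderOf_dvd_iff_pow_eq_one, ← Units.val_inj, Units.val_pow_eq_pow_val,
      ← hcast, ← ZMod.natCast_eq_zero_iff, Nat.cast_sub (Nat.one_le_pow _ _ hpos), sub_eq_zero]
    simp
  have h1 : 1 < h := by
    refine lt_of_le_of_ne hpos fun h1 => ?_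
    have := (hsq 1).mp (by simp [← h1])
    have h3 := Nat.le_of_dvd one_pos this
    have : 1 ≤ q - 1 := by omega
    nlinarith
  have hdvd : ∀ k, q ∣ h ^ k - 1 → q - 1 ∣ k := by
    intro k hk
    have h2 : q ^ 2 ∣ h ^ (k * q) - 1 := by
      have hmod : h ^ k ≡ 1 [MOD q] :=
        ((Nat.modEq_iff_dvd' (Nat.one_le_pow _ _ hpos)).mpr hk).symm
      have hi : (q : ℤ) ∣ ((h ^ k : ℕ) : ℤ) - 1 := by
        simpa using (Nat.modEq_iff_dvd.mp hmod.symm)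
      have h4 := dvd_sub_pow_of_dvd_sub (R := ℤ) (p := q) hi 1
      have h5 : ((q ^ 2 : ℕ) : ℤ) ∣ ((h ^ (k * q) - 1 : ℕ) : ℤ) := by
        rw [Nat.cast_sub (Nat.one_le_pow _ _ hpos), pow_mul]
        push_cast at h4 ⊢
        simpa using h4
      exact Int.natCast_dvd_natCast.mp h5
    exact Nat.dvd_of_mul_dvd_mul_left hq.pos (mul_comm k q ▸ (hsq _).mp h2)
  have hfermat : q ∣ h ^ (q - 1) - 1 :=
    (Nat.modEq_iff_dvd' (Nat.one_le_pow _ _ hpos)).mp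
      (Nat.ModEq.symm (Nat.totient_prime hq ▸ Nat.ModEq.pow_totient
        ((Nat.Prime.coprime_iff_not_dvd hq).mpr hqh).symm))
  have hbase1 : 1 < h ^ (q - 1) := Nat.one_lt_pow (by omega) h1
  have hbase : padicValNat q (h ^ (q - 1) - 1) = 1 := by
    have hne : h ^ (q - 1) - 1 ≠ 0 := by omega
    refine le_antisymm ?_ (one_le_padicValNat_of_dvd hne hfermat)
    by_contra hlt
    have h2 := (hsq (q - 1)).mp ((padicValNat_dvd_iff_le hne).mpr (by omega))
    have h3 := Nat.le_of_dvd (by omega) h2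
    have : 1 ≤ q - 1 := by omega
    nlinarith
  refine ⟨h, h1, hqh, hdvd, ?_⟩
  rintro k hk ⟨m, rfl⟩
  have hm : m ≠ 0 := right_ne_zero_of_mul hk
  have := padicValNat.pow_sub_pow (p := q) (hq.odd_of_ne_two hq2) hbase1 hfermat
    (fun h' => hqh (hq.dvd_of_dvd_pow h')) hm
  rw [one_pow, hbase] at this
  rw [pow_mul, this, padicValNat.mul (by omega) hm, padicValNat.eq_zero_of_not_dvd
    (n := q - 1) fun h' => by have := Nat.le_of_dvd (by omega) h'; omega, zero_add]

theorem padicValNat_two_five_pow_sub_one {n : ℕ} (hn : n ≠ 0) :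
    padicValNat 2 (5 ^ n - 1) = 1 + padicValNat 2 (2 * n) := by
  have h5 : 1 < 5 ^ n := Nat.one_lt_pow hn (by norm_num)
  have h := Int.two_pow_sub_pow' (x := 5) (y := 1) n (by norm_num) (by norm_num)
  have h4 : emultiplicity (2 : ℤ) (5 - 1) = (2 : ℕ) := by
    refine emultiplicity_eq_coe.mpr ⟨by norm_num, by norm_num⟩
  have hcast : (5 : ℤ) ^ n - 1 ^ n = ((5 ^ n - 1 : ℕ) : ℤ) := by
    rw [Nat.cast_sub h5.le]
    simp
  rw [h4, hcast, show (2 : ℤ) = ((2 : ℕ) : ℤ) from rfl, Int.natCast_emultiplicity,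
    Int.natCast_emultiplicity, ← padicValNat_eq_emultiplicity (by omega),
    ← padicValNat_eq_emultiplicity hn] at h
  rw [padicValNat.mul two_ne_zero hn, padicValNat.self (by norm_num)]
  have : padicValNat 2 (5 ^ n - 1) = 2 + padicValNat 2 n := by exact_mod_cast h
  omega

/-- Some power sequence `g ^ n - 1` has the same `q`-parts as the denominators of
`B_{2n} / (2n)`. -/
theorem exists_padicValNat_pow_sub_one_eq_den {q : ℕ} (hq : q.Prime) :
    ∃ g : ℕ, 1 < g ∧ ∀ n : ℕ, n ≠ 0 →
      padicValNat q (g ^ n - 1) = padicValNat q (bernoulli (2 * n) / (2 * n : ℚ)).den := by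
  rcases eq_or_ne q 2 with rfl | hq2
  · refine ⟨5, by norm_num, fun n hn => ?_⟩
    rw [padicValNat_two_five_pow_sub_one hn,
      padicValNat_den_bernoulli_div_of_dvd hq hn (one_dvd _)]
  · obtain ⟨h, h1, hqh, hdvd, hval⟩ := exists_padicValNat_pow_sub_one hq hq2
    refine ⟨h ^ 2, Nat.one_lt_pow two_ne_zero h1, fun n hn => ?_⟩
    rw [← pow_mul]
    by_cases hd : q - 1 ∣ 2 * n
    · rw [hval _ (by omega) hd, padicValNat_den_bernoulli_div_of_dvd hq hn hd]
    · have hnd : ¬ q ∣ h ^ (2 * n) - 1 := fun h' => hd (hdvd _ h')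
      have := padicValNat_den_bernoulli_div_eq_zero hq (k := 2 * n) (by omega) hqh (by
        intro h'
        refine hnd (Int.natCast_dvd_natCast.mp ?_)
        rw [Nat.cast_sub (Nat.one_le_pow _ _ (by omega))]
        exact_mod_cast h')
      rw [padicValNat.eq_zero_of_not_dvd hnd]
      push_cast at this
      exact this.symm

/-- On the Prüfer `q`-group, the `M`-torsion is the group of roots of unity of order the
`q`-part of `M`. -/
theorem image_val_primaryComponent_pow_eq_one {q : ℕ} [Fact q.Prime] {M : ℕ} (hM : M ≠ 0) :
    Subtype.val '' {x : CommGroup.primaryComponent ℂˣ q | x ^ M = 1} =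
      (rootsOfUnity (q ^ padicValNat q M) ℂ : Set ℂˣ) := by
  ext z
  simp only [Set.mem_image, Set.mem_ofPred_eq, SetLike.mem_coe, mem_rootsOfUnity]
  constructor
  · rintro ⟨⟨x, j, hj⟩, hx, rfl⟩
    have hx' : x ^ M = 1 := congrArg Subtype.val hx
    obtain ⟨i, -, hi⟩ := (Nat.dvd_prime_pow Fact.out).mp (orderOf_dvd_of_pow_eq_one hj)
    rw [← orderOf_dvd_iff_pow_eq_one, hi] at hx' ⊢
    exact pow_dvd_pow _ ((padicValNat_dvd_iff_le hM).mp hx')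
  · intro hz
    refine ⟨⟨z, _, hz⟩, Subtype.ext ?_, rfl⟩
    exact orderOf_dvd_iff_pow_eq_one.mp ((orderOf_dvd_of_pow_eq_one hz).trans pow_padicValNat_dvd)

/-- For every prime `q`, the sequence of `q`-parts of the denominators of
`B_{2n}/(2n)` is algebraically realizable. -/
theorem stmt_12 (q : ℕ) (hq : q.Prime) :
    ∃ (G : Type) (_ : Group G) (θ : G →* G),
      ∀ n : ℕ, 1 ≤ n → {x : G | (⇑θ)^[n] x = x}.Finite ∧
        {x : G | (⇑θ)^[n] x = x}.ncard =
          q ^ padicValNat q ((bernoulli (2 * n) / (2 * n : ℚ)).den) := by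
  have := Fact.mk hq
  obtain ⟨g, hg, hval⟩ := exists_padicValNat_pow_sub_one_eq_den hq
  refine ⟨CommGroup.primaryComponent ℂˣ q, inferInstance, powMonoidHom g, fun n hn => ?_⟩
  have hgn : 1 < g ^ n := Nat.one_lt_pow (by omega) hg
  have hfix : {x : CommGroup.primaryComponent ℂˣ q | (⇑(powMonoidHom g))^[n] x = x} =
      {x | x ^ (g ^ n - 1) = 1} := by
    ext x
    have hit : (⇑(powMonoidHom g))^[n] x = x ^ g ^ n := by
      simp [powMonoidHom]
    rw [Set.mem_ofPred_eq, Set.mem_ofPred_eq, hit, pow_sub x hgn.le, pow_one, mul_inv_eq_one]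
  have himg := image_val_primaryComponent_pow_eq_one (q := q) (M := g ^ n - 1) (by omega)
  rw [hval n (by omega)] at himg
  have : NeZero (q ^ padicValNat q (bernoulli (2 * n) / (2 * n : ℚ)).den) :=
    ⟨pow_ne_zero _ hq.ne_zero⟩
  have hcard : {x : CommGroup.primaryComponent ℂˣ q | x ^ (g ^ n - 1) = 1}.ncard =
      q ^ padicValNat q (bernoulli (2 * n) / (2 * n : ℚ)).den := by
    rw [← Set.ncard_image_of_injective _ Subtype.val_injective, himg, ← Nat.card_coe_set_eq]
    exact Complex.card_rootsOfUnity (q ^ _)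
  rw [hfix]
  exact ⟨Set.finite_of_ncard_pos (hcard ▸ pow_pos hq.pos _), hcard⟩
end

section
/- Let p be an odd prime and let γ > 1 be an integer which is a primitive root modulo p (its residue class generates the multiplicative group of units modulo p) and satisfies p² ∤ γ^{p−1} − 1. Let m, r ≥ 1 be integers with p ∤ m, let n be the integer with 2n = p^r(p−1)m, and let k = n/p. Then there exist integers c and d, neither divisible by p, such that γ^{2n} − 1 = p^{r+1}·c, γ^{2k} − 1 = p^r·d, and c ≡ d (mod p^r). -/
theorem exists_one_add_pow_eq_cubic_remainder {R : Type*} [CommRing R] (y : R) (n : ℕ) :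
    ∃ z, (1 + y) ^ n = 1 + n * y + n.choose 2 * y ^ 2 + y ^ 3 * z := by
  induction n with
  | zero => exact ⟨0, by simp⟩
  | succ n ih =>
    obtain ⟨z, hz⟩ := ih
    refine ⟨n.choose 2 + z + y * z, ?_⟩
    rw [pow_succ, hz, Nat.choose_succ_succ' n 1, Nat.choose_one_right]
    push_cast
    ring

theorem exists_one_add_prime_pow_mul_pow_prime {p : ℕ} (hp : p.Prime) (hp2 : p ≠ 2)
    {s : ℕ} (hs : 1 ≤ s) (d : ℤ) :
    ∃ e : ℤ, (1 + (p : ℤ) ^ s * d) ^ p = 1 + (p : ℤ) ^ (s + 1) * (d + (p : ℤ) ^ s * e) := by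
  obtain ⟨z, hz⟩ := exists_one_add_pow_eq_cubic_remainder ((p : ℤ) ^ s * d) p
  have h2 : 2 < p := lt_of_le_of_ne hp.two_le hp2.symm
  obtain ⟨q, hq⟩ := hp.dvd_choose_self two_ne_zero h2
  obtain ⟨t, rfl⟩ := Nat.exists_eq_add_of_le' hs
  refine ⟨q * d ^ 2 + (p : ℤ) ^ t * d ^ 3 * z, ?_⟩
  rw [hz, hq]
  push_cast
  ring

theorem exists_pow_prime_pow_mul_eq_one_add {p : ℕ} (hp : p.Prime) (hp2 : p ≠ 2)
    {x a : ℤ} (hx : x = 1 + p * a) (ha : ¬ (p : ℤ) ∣ a) (s : ℕ) :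
    ∃ d : ℤ, ¬ (p : ℤ) ∣ d ∧ x ^ p ^ s = 1 + (p : ℤ) ^ (s + 1) * d := by
  induction s with
  | zero => exact ⟨a, ha, by simpa using hx⟩
  | succ s ih =>
    obtain ⟨d, hd, h⟩ := ih
    obtain ⟨e, he⟩ := exists_one_add_prime_pow_mul_pow_prime hp hp2 (Nat.le_add_left 1 s) d
    refine ⟨d + (p : ℤ) ^ (s + 1) * e, ?_, by rw [pow_succ p, pow_mul, h, he]⟩
    rwa [dvd_add_left (dvd_mul_of_dvd_left (dvd_pow_self _ s.succ_ne_zero) e)]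

/-- For an odd prime `p`, a primitive root `γ > 1` modulo `p` with
`p² ∤ γ^(p-1) - 1`, and `2n = p^r (p-1) m` with `p ∤ m`, `k = n/p`, the integers
`c = (γ^(2n) - 1)/p^(r+1)` and `d = (γ^(2k) - 1)/p^r` are not divisible by `p` and are
congruent modulo `p^r`. -/
theorem stmt_13 (p : ℕ) (hp : p.Prime) (hp2 : p ≠ 2)
    (γ : ℤ) (hγ : 1 < γ)
    (hprim : orderOf (γ : ZMod p) = p - 1)
    (hgood : ¬ ((p : ℤ) ^ 2 ∣ γ ^ (p - 1) - 1))
    (m r : ℕ) (hm : 1 ≤ m) (hr : 1 ≤ r) (hpm : ¬ p ∣ m)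
    (n k : ℕ) (hn : 2 * n = p ^ r * (p - 1) * m) (hk : n = p * k) :
    ∃ c d : ℤ, ¬ (p : ℤ) ∣ c ∧ ¬ (p : ℤ) ∣ d ∧
      γ ^ (2 * n) - 1 = (p : ℤ) ^ (r + 1) * c ∧
      γ ^ (2 * k) - 1 = (p : ℤ) ^ r * d ∧
      (p : ℤ) ^ r ∣ c - d := by

  have := Fact.mk hp
  have hpZ : Prime (p : ℤ) := Nat.prime_iff_prime_int.mp hp
  obtain ⟨s, rfl⟩ := Nat.exists_eq_add_of_le' hr
  have hk2 : 2 * k = (p - 1) * m * p ^ s := by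
    apply Nat.eq_of_mul_eq_mul_left hp.pos
    calc p * (2 * k) = 2 * n := by rw [hk]; ring
      _ = p * ((p - 1) * m * p ^ s) := by rw [hn]; ring
  obtain ⟨b, hb⟩ : (p : ℤ) ∣ γ ^ (p - 1) - 1 := by
    rw [← ZMod.intCast_zmod_eq_zero_iff_dvd]
    push_cast
    rw [← hprim, pow_orderOf_eq_one, sub_self]
  have hpb : ¬ (p : ℤ) ∣ b := fun h => hgood (by rw [hb, sq]; exact mul_dvd_mul_left _ h)
  obtain ⟨z, hz⟩ := exists_one_add_pow_eq_cubic_remainder ((p : ℤ) * b) m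
  have hx : γ ^ ((p - 1) * m) =
      1 + p * (m * b + p * (m.choose 2 * b ^ 2 + p * b ^ 3 * z)) := by
    rw [pow_mul, eq_add_of_sub_eq' hb, hz]
    ring
  have ha : ¬ (p : ℤ) ∣ m * b + p * (m.choose 2 * b ^ 2 + p * b ^ 3 * z) := by
    rw [dvd_add_left (dvd_mul_right _ _), hpZ.dvd_mul, Int.natCast_dvd_natCast]
    exact not_or.mpr ⟨hpm, hpb⟩
  obtain ⟨d, hd, h⟩ := exists_pow_prime_pow_mul_eq_one_add hp hp2 hx ha s
  rw [← pow_mul, ← hk2] at h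
  obtain ⟨e, he⟩ := exists_one_add_prime_pow_mul_pow_prime hp hp2 hr d
  refine ⟨d + (p : ℤ) ^ (s + 1) * e, d, ?_, hd, ?_, by rw [h]; ring, ⟨e, by ring⟩⟩
  · rwa [dvd_add_left (dvd_mul_of_dvd_left (dvd_pow_self _ s.succ_ne_zero) e)]
  · rw [hk, show 2 * (p * k) = 2 * k * p by ring, pow_mul, h, he]
    ring
end

section
/- Let n ≥ 2 be an even integer, let r = ν_2(n) be the 2-adic valuation of n, and let k = n/2. Then the rational number x = (5^n − 1)·B_{2n}/(2n) − (5^k − 1)·B_{2k}/(2k) satisfies x = 0 or ν_2(x) ≥ r, where ν_2 denotes the 2-adic valuation on the rationals; that is, (5^n − 1)·B_{2n}/(2n) ≡ (5^k − 1)·B_{2k}/(2k) (mod 2^r). -/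
open Filter Topology in
/-- The Bernoulli number `B_m` is the 2-adic limit of `(0^m + 1^m + ⋯ + (2^N - 1)^m) / 2^N`. -/
theorem tendsto_sum_range_pow_div_bernoulli (m : ℕ) :
    Tendsto (fun N : ℕ => (∑ j ∈ Finset.range (2 ^ N), (j : ℚ_[2]) ^ m) / 2 ^ N) atTop
      (𝓝 ((bernoulli m : ℚ) : ℚ_[2])) := by
  have hform : ∀ N : ℕ, (∑ j ∈ Finset.range (2 ^ N), (j : ℚ_[2]) ^ m) / 2 ^ N =
      ∑ i ∈ Finset.range (m + 1), ((bernoulli i * (m + 1).choose i / (m + 1) : ℚ) : ℚ_[2]) *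
        ((2 : ℚ_[2]) ^ N) ^ (m - i) := by
    intro N
    have h := congrArg (fun q : ℚ => (q : ℚ_[2])) (sum_range_pow (2 ^ N) m)
    push_cast at h
    rw [h, Finset.sum_div]
    refine Finset.sum_congr rfl fun i hi => ?_
    have hi' : m + 1 - i = (m - i) + 1 := by
      have := Finset.mem_range.mp hi
      omega
    have h2 : ((2 : ℚ_[2]) ^ N) ≠ 0 := pow_ne_zero _ two_ne_zero
    rw [hi', pow_succ]
    push_cast
    field_simp
  have hpow : Tendsto (fun N : ℕ => (2 : ℚ_[2]) ^ N) atTop (𝓝 0) := by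
    refine tendsto_pow_atTop_nhds_zero_of_norm_lt_one ?_
    simpa using Padic.norm_p_lt_one (p := 2)
  have hlim : Tendsto (fun N : ℕ => ∑ i ∈ Finset.range (m + 1),
      ((bernoulli i * (m + 1).choose i / (m + 1) : ℚ) : ℚ_[2]) *
        ((2 : ℚ_[2]) ^ N) ^ (m - i)) atTop
      (𝓝 (∑ i ∈ Finset.range (m + 1),
        ((bernoulli i * (m + 1).choose i / (m + 1) : ℚ) : ℚ_[2]) * (0 : ℚ_[2]) ^ (m - i))) :=
    tendsto_finsetSum _ fun i _ => (hpow.pow _).const_mul _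
  have hval : ∑ i ∈ Finset.range (m + 1),
      ((bernoulli i * (m + 1).choose i / (m + 1) : ℚ) : ℚ_[2]) * (0 : ℚ_[2]) ^ (m - i) =
      ((bernoulli m : ℚ) : ℚ_[2]) := by
    rw [Finset.sum_range_succ, Finset.sum_eq_zero, zero_add, Nat.sub_self, pow_zero, mul_one]
    · have : (m + 1 : ℚ) ≠ 0 := by positivity
      congr 1
      rw [Nat.choose_succ_self_right]
      push_cast
      field_simp
    · intro i hi
      have : m - i ≠ 0 := by
        have := Finset.mem_range.mp hi
        omega
      rw [zero_pow this, mul_zero]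
  simp_rw [hform]
  rwa [hval] at hlim

theorem two_pow_dvd_pow_sub_pow {a b : ℤ} {N r m : ℕ} (hN : 1 ≤ N)
    (h : (2 : ℤ) ^ N ∣ a - b) (hm : 2 ^ r ∣ m) : (2 : ℤ) ^ (N + r) ∣ a ^ m - b ^ m := by
  obtain ⟨c, rfl⟩ := hm
  suffices hr : (2 : ℤ) ^ (N + r) ∣ a ^ 2 ^ r - b ^ 2 ^ r by
    rw [pow_mul, pow_mul]
    exact hr.trans (sub_dvd_pow_sub_pow _ _ c)
  clear c
  induction r with
  | zero => simpa using h
  | succ r ih =>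
    have h2 : (2 : ℤ) ∣ a ^ 2 ^ r - b ^ 2 ^ r := (dvd_pow_self 2 (by omega)).trans ih
    have hs : (2 : ℤ) ∣ a ^ 2 ^ r + b ^ 2 ^ r := by omega
    have hfac : a ^ 2 ^ (r + 1) - b ^ 2 ^ (r + 1) =
        (a ^ 2 ^ r - b ^ 2 ^ r) * (a ^ 2 ^ r + b ^ 2 ^ r) := by
      rw [pow_succ 2 r, pow_mul, pow_mul]
      ring
    rw [hfac, ← add_assoc, pow_succ]
    exact mul_dvd_mul ih hs

theorem two_pow_dvd_sum_range_pow_sub {r m : ℕ} (hm0 : m ≠ 0) (hm : 2 ^ r ∣ m) (N : ℕ) :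
    (2 : ℤ) ^ (N + r) ∣ ∑ j ∈ Finset.range (2 ^ (N + 1)), (j : ℤ) ^ m - 2 ^ N := by
  induction N with
  | zero => simp [Finset.sum_range_succ, hm0]
  | succ N ih =>
    have hsplit : ∑ j ∈ Finset.range (2 ^ (N + 1 + 1)), (j : ℤ) ^ m - 2 ^ (N + 1) =
        2 * (∑ j ∈ Finset.range (2 ^ (N + 1)), (j : ℤ) ^ m - 2 ^ N) +
        ∑ j ∈ Finset.range (2 ^ (N + 1)), (((2 ^ (N + 1) + j : ℕ) : ℤ) ^ m - (j : ℤ) ^ m) := by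
      rw [pow_succ 2 (N + 1), mul_two, Finset.sum_range_add, Finset.sum_sub_distrib]
      ring
    rw [hsplit]
    refine dvd_add ?_ (Finset.dvd_sum fun j _ => ?_)
    · rw [add_right_comm, pow_succ']
      exact mul_dvd_mul_left 2 ih
    · exact two_pow_dvd_pow_sub_pow (by omega) (by simp) hm

/-- Carlitz's congruence at the prime 2: `2 B_m ≡ 1 (mod 2^r)` whenever `2^r ∣ m`. -/
theorem norm_two_mul_bernoulli_sub_one_le {r m : ℕ} (hm0 : m ≠ 0) (hm : 2 ^ r ∣ m) :
    ‖2 * ((bernoulli m : ℚ) : ℚ_[2]) - 1‖ ≤ (2 : ℝ) ^ (-r : ℤ) := by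
  have hlim := ((((tendsto_sum_range_pow_div_bernoulli m).comp
    (Filter.tendsto_add_atTop_nat 1)).const_mul 2).sub_const 1).norm
  refine le_of_tendsto' hlim fun N => ?_
  obtain ⟨c, hc⟩ := two_pow_dvd_sum_range_pow_sub hm0 hm N
  have hc' := congrArg (fun z : ℤ => (z : ℚ_[2])) hc
  push_cast at hc'
  have h2 : ((2 : ℚ_[2]) ^ N) ≠ 0 := pow_ne_zero _ two_ne_zero
  have heq : 2 * ((∑ j ∈ Finset.range (2 ^ (N + 1)), (j : ℚ_[2]) ^ m) / 2 ^ (N + 1)) - 1 =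
      ((2 ^ r * c : ℤ) : ℚ_[2]) := by
    rw [sub_eq_iff_eq_add.mp hc']
    push_cast
    field_simp
    ring
  simp only [Function.comp_apply]
  rw [heq]
  have := (Padic.norm_int_le_pow_iff_dvd (p := 2) (2 ^ r * c) r).mpr (by simp)
  simpa using this

theorem norm_five_pow_sub_one_div_le_one (k : ℕ) :
    ‖((5 : ℚ_[2]) ^ k - 1) / (4 * k)‖ ≤ 1 := by
  rcases eq_or_ne k 0 with rfl | hk
  · simp
  obtain ⟨s, q, hq, rfl⟩ := Nat.exists_eq_two_pow_mul_odd hk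
  have hdvd : (2 : ℤ) ^ (2 + s) ∣ 5 ^ (2 ^ s * q) - 1 ^ (2 ^ s * q) :=
    two_pow_dvd_pow_sub_pow (by omega) (by norm_num) (dvd_mul_right _ _)
  obtain ⟨c, hc⟩ := hdvd
  have hc' := congrArg (fun z : ℤ => (z : ℚ_[2])) hc
  push_cast at hc'
  rw [one_pow] at hc'
  have hq1 : ‖(q : ℚ_[2])‖ = 1 := by
    rw [Padic.norm_natCast_eq_one_iff]
    exact (Nat.coprime_two_left).mpr hq
  have h2 : ((2 : ℚ_[2]) ^ s) ≠ 0 := pow_ne_zero _ two_ne_zero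
  have hq0 : (q : ℚ_[2]) ≠ 0 := by
    rw [← norm_ne_zero_iff, hq1]
    exact one_ne_zero
  have heq : ((5 : ℚ_[2]) ^ (2 ^ s * q) - 1) / (4 * ((2 ^ s * q : ℕ) : ℚ_[2])) = c / q := by
    rw [hc']
    push_cast
    field_simp
    ring
  rw [heq, norm_div, hq1, div_one]
  exact Padic.norm_int_le_one c

/-- Young's congruence at the prime 2: for even `n ≥ 2` with `r = ν₂(n)` and
`k = n/2`, `(5^n - 1)·B_{2n}/(2n) ≡ (5^k - 1)·B_{2k}/(2k) (mod 2^r)`, i.e. the difference is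
zero or has 2-adic valuation at least `r`. -/
theorem stmt_14 (n : ℕ) (hn : 2 ≤ n) (r : ℕ) (hr : r = padicValNat 2 n)
    (k : ℕ) (hk : n = 2 * k) :
    (5 ^ n - 1 : ℚ) * bernoulli (2 * n) / (2 * n) -
        (5 ^ k - 1 : ℚ) * bernoulli (2 * k) / (2 * k) = 0 ∨
      (r : ℤ) ≤ padicValRat 2
        ((5 ^ n - 1 : ℚ) * bernoulli (2 * n) / (2 * n) -
          (5 ^ k - 1 : ℚ) * bernoulli (2 * k) / (2 * k)) := by
  have hrn : 2 ^ r ∣ n := hr ▸ pow_padicValNat_dvd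
  set x : ℚ := (5 ^ n - 1 : ℚ) * bernoulli (2 * n) / (2 * n) -
    (5 ^ k - 1 : ℚ) * bernoulli (2 * k) / (2 * k) with hx
  have hk0 : (k : ℚ_[2]) ≠ 0 := by
    have : k ≠ 0 := by omega
    exact_mod_cast this
  set b := ((bernoulli (2 * n) : ℚ) : ℚ_[2])
  set b' := ((bernoulli (2 * k) : ℚ) : ℚ_[2])
  set u := ((5 : ℚ_[2]) ^ n - 1) / (4 * n) with hu
  set u' := ((5 : ℚ_[2]) ^ k - 1) / (4 * k) with hu'
  have hb : ‖2 * b - 1‖ ≤ (2 : ℝ) ^ (-r : ℤ) :=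
    norm_two_mul_bernoulli_sub_one_le (by omega) (hrn.mul_left 2)
  have hb' : ‖2 * b' - 1‖ ≤ (2 : ℝ) ^ (-r : ℤ) :=
    norm_two_mul_bernoulli_sub_one_le (by omega) (hk ▸ hrn)
  have hu1 : ‖u‖ ≤ 1 := norm_five_pow_sub_one_div_le_one n
  have hu1' : ‖u'‖ ≤ 1 := norm_five_pow_sub_one_div_le_one k
  have hn1 : ‖(n : ℚ_[2])‖ ≤ (2 : ℝ) ^ (-r : ℤ) := by
    have := (Padic.norm_int_le_pow_iff_dvd (p := 2) (n : ℤ) r).mpr (by exact_mod_cast hrn)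
    simpa using this
  have hxeq : (x : ℚ_[2]) = (2 * b - 1) * u - (2 * b' - 1) * u' + n * (u' * u') := by
    have hnk : (n : ℚ_[2]) = 2 * k := by exact_mod_cast hk
    have h5 : (5 : ℚ_[2]) ^ n = (5 ^ k) ^ 2 := by rw [hk, mul_comm, pow_mul]
    rw [hx, hu, hu']
    push_cast
    rw [h5, hnk]
    field_simp
    ring
  have hmul : ∀ {y z : ℚ_[2]}, ‖y‖ ≤ (2 : ℝ) ^ (-r : ℤ) → ‖z‖ ≤ 1 →
      ‖y * z‖ ≤ (2 : ℝ) ^ (-r : ℤ) := fun hy hz => by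
    rw [norm_mul]
    exact (mul_le_of_le_one_right (norm_nonneg _) hz).trans hy
  have hxnorm : ‖(x : ℚ_[2])‖ ≤ (2 : ℝ) ^ (-r : ℤ) := by
    rw [hxeq, sub_eq_add_neg]
    refine (Padic.nonarchimedean _ _).trans (max_le ?_ (hmul hn1 ?_))
    · refine (Padic.nonarchimedean _ _).trans (max_le (hmul hb hu1) ?_)
      rw [norm_neg]
      exact hmul hb' hu1'
    · rw [norm_mul]
      exact mul_le_one₀ hu1' (norm_nonneg _) hu1'
  refine or_iff_not_imp_left.mpr fun hx0 => ?_
  rw [Padic.eq_padicNorm, padicNorm.eq_zpow_of_nonzero hx0] at hxnorm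
  push_cast at hxnorm
  have := (zpow_le_zpow_iff_right₀ (one_lt_two (α := ℝ))).mp hxnorm
  omega
end

section
/- Let t(n) denote the absolute value of the numerator of the rational number B_{2n}/(2n) in lowest terms, and let p be a Bernoulli regular prime, meaning p = 2, or p = 3, or p ≥ 5 and p does not divide t(k) for any k with 1 ≤ k ≤ (p−3)/2. Then p does not divide t(n) for any n ≥ 1; in particular the p-part sequence n ↦ p^{ν_p(t(n))} is the constant sequence 1. -/
open Finset in
/-- Multiplication by a unit modulo `N` permutes the residues. -/
lemma sum_range_mul_mod_eq {M : Type*} [AddCommMonoid M] {a N : ℕ} (hN : 0 < N)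
    (h : N.Coprime a) (f : ℕ → M) :
    ∑ j ∈ range N, f (j * a % N) = ∑ j ∈ range N, f j := by
  have hmaps : Set.MapsTo (fun j ↦ j * a % N) (range N : Set ℕ) (range N : Set ℕ) :=
    fun j _ ↦ by simpa using Nat.mod_lt _ hN
  have hinj : Set.InjOn (fun j ↦ j * a % N) (range N : Set ℕ) := by
    intro i hi j hj hij
    simp only [coe_range, Set.mem_Iio] at hi hj
    exact Nat.ModEq.eq_of_lt_of_lt (Nat.ModEq.cancel_right_of_coprime h hij) hi hj
  exact sum_nbij (fun j ↦ j * a % N) hmaps hinj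
    (surjOn_of_injOn_of_card_le _ hmaps hinj le_rfl) fun _ _ ↦ rfl

/-- The first two terms of the binomial expansion of `(q * N + r) ^ m`. -/
lemma sq_dvd_pow_sub_pow_mod_sub (x N m : ℕ) :
    (N : ℤ) ^ 2 ∣ (x : ℤ) ^ m - ((x % N : ℕ) : ℤ) ^ m -
      m * N * ((x / N : ℕ) * (x : ℤ) ^ (m - 1)) := by
  rcases m with _ | m
  · simp
  have hx : ((x % N : ℕ) : ℤ) = x - N * (x / N : ℕ) := by
    have := Nat.mod_add_div x N
    zify at this ⊢
    linarith
  rw [hx]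
  generalize ((x / N : ℕ) : ℤ) = q
  obtain ⟨k, hk⟩ := Polynomial.powAddExpansion (x : ℤ) (-(N * q)) (m + 1)
  refine ⟨-(k * q ^ 2), ?_⟩
  rw [sub_eq_add_neg (x : ℤ), hk]
  push_cast
  ring

open Finset in
/-- The integral form of Voronoi's congruence. -/
lemma sq_dvd_sub_sum_pow_mul_floor {a N : ℕ} (hN : 0 < N) (h : N.Coprime a) (m : ℕ) :
    (N : ℤ) ^ 2 ∣ ((a : ℤ) ^ m - 1) * ∑ j ∈ range N, (j : ℤ) ^ m -
      m * N * ∑ j ∈ range N, ((j * a / N : ℕ) * ((j * a : ℕ) : ℤ) ^ (m - 1)) := by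
  have key := dvd_sum fun j (_ : j ∈ range N) ↦ sq_dvd_pow_sub_pow_mod_sub (j * a) N m
  rw [sum_sub_distrib, sum_sub_distrib,
    sum_range_mul_mod_eq hN h fun j ↦ (j : ℤ) ^ m, ← mul_sum] at key
  simpa only [sub_mul, one_mul, mul_sum, sum_sub_distrib, Nat.cast_mul, mul_pow,
    mul_comm ((a : ℤ) ^ m)] using key

lemma factorization_succ_lt {p d : ℕ} (hp5 : 5 ≤ p) (hd : 2 ≤ d) :
    (d + 1).factorization p < d - 1 := by
  by_contra! h
  have h1 : p ^ (d - 1) ∣ d + 1 := (pow_dvd_pow p h).trans (Nat.ordProj_dvd _ _)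
  have h2 := Nat.le_of_dvd (by lia) h1
  have h3 : ∀ e : ℕ, 1 ≤ e → e + 2 < 5 ^ e := by
    intro e he
    induction e, he using Nat.le_induction with
    | base => norm_num
    | succ e he ih => rw [pow_succ]; lia
  have h4 := h3 (d - 1) (by lia)
  have h5 := Nat.pow_le_pow_left hp5 (d - 1)
  lia

/-- The subring of `p`-integral rational numbers. -/
abbrev pIntegers (p : ℕ) [Fact p.Prime] : Subring ℚ := (Rat.padicValuation p).integer

section pIntegers

variable {p : ℕ} [Fact p.Prime]

lemma mem_pIntegers_iff {x : ℚ} : x ∈ pIntegers p ↔ ¬ p ∣ x.den :=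
  Rat.padicValuation_le_one_iff

lemma inv_intCast_mem_pIntegers {u : ℤ} (hu : ¬ (p : ℤ) ∣ u) : (u : ℚ)⁻¹ ∈ pIntegers p := by
  rw [mem_pIntegers_iff, Rat.inv_intCast_den]
  split_ifs with h
  · simp [h] at hu
  · rwa [← Int.natCast_dvd]

lemma pow_div_natCast_mem_pIntegers {M s : ℕ} (hM : M ≠ 0) (hs : M.factorization p ≤ s) :
    (p : ℚ) ^ s / M ∈ pIntegers p := by
  have hp : p.Prime := Fact.out
  have hp0 : (p : ℚ) ≠ 0 := mod_cast hp.ne_zero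
  have hu := Nat.not_dvd_ordCompl hp hM
  have hdec := Nat.ordProj_mul_ordCompl_eq_self M p
  set e := M.factorization p
  set u := M / p ^ e
  have hu0 : (u : ℚ) ≠ 0 := by
    rintro h
    rw [Nat.cast_eq_zero] at h
    simp [h] at hu
  have hEq : (p : ℚ) ^ s / M = ((p ^ (s - e) : ℕ) : ℚ) * ((u : ℤ) : ℚ)⁻¹ := by
    rw [← hdec, ← Nat.sub_add_cancel hs]
    push_cast
    rw [pow_add, Nat.add_sub_cancel]
    field_simp
  rw [hEq]
  exact mul_mem (natCast_mem _ _) (inv_intCast_mem_pIntegers (mod_cast hu))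

lemma dvd_num_iff_exists_mem_pIntegers {x : ℚ} :
    p ∣ x.num.natAbs ↔ ∃ y ∈ pIntegers p, x = p * y := by
  have hp : p.Prime := Fact.out
  rw [← Int.natCast_dvd]
  constructor
  · rintro ⟨c, hc⟩
    refine ⟨c * ((x.den : ℤ) : ℚ)⁻¹, mul_mem (intCast_mem _ _) (inv_intCast_mem_pIntegers ?_), ?_⟩
    · intro hd
      have h1 : p ∣ x.num.natAbs := Int.natCast_dvd.1 ⟨c, hc⟩
      exact Nat.not_coprime_of_dvd_of_dvd hp.one_lt h1 (mod_cast hd) x.reduced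
    · conv_lhs => rw [← Rat.num_div_den x, hc]
      push_cast
      ring
  · rintro ⟨y, hy, rfl⟩
    rw [mem_pIntegers_iff] at hy
    have h := Rat.mul_num_den' (p : ℚ) y
    simp only [Rat.num_natCast, Rat.den_natCast, Nat.cast_one, mul_one] at h
    have h2 : (p : ℤ) ∣ ((p : ℚ) * y).num * y.den := by
      rw [h, mul_assoc]
      exact dvd_mul_right _ _
    exact (Int.Prime.dvd_mul' hp h2).resolve_right fun h ↦ hy (mod_cast h)

lemma dvd_of_intCast_eq_mul {z : ℤ} {y : ℚ} (hy : y ∈ pIntegers p) (h : (z : ℚ) = p * y) :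
    (p : ℤ) ∣ z := by
  have := dvd_num_iff_exists_mem_pIntegers.2 ⟨y, hy, h⟩
  rwa [Rat.num_intCast, ← Int.natCast_dvd] at this

open Finset in
/-- The part of the von Staudt–Clausen theorem concerning a single prime. -/
lemma bernoulli_add_indicator_mem_pIntegers {k : ℕ} (hk : 0 < k) :
    bernoulli (2 * k) + (if (p - 1) ∣ 2 * k then (1 : ℚ) / p else 0) ∈ pIntegers p := by
  have hp : p.Prime := Fact.out
  obtain ⟨z, hz⟩ := Bernoulli.vonStaudt_clausen k
  set s := {q ∈ range (2 * k + 2) | q.Prime ∧ (q - 1) ∣ 2 * k}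
  have hrest : ∑ q ∈ s.erase p, (1 : ℚ) / q ∈ pIntegers p := by
    refine sum_mem fun q hq ↦ ?_
    simp only [s, mem_erase, mem_filter] at hq
    have := inv_intCast_mem_pIntegers (p := p) (u := q) fun h ↦
      hq.1 ((Nat.prime_dvd_prime_iff_eq hp hq.2.2.1).1 (mod_cast h)).symm
    simpa using this
  have hsum : ∑ q ∈ s, (1 : ℚ) / q =
      (if (p - 1) ∣ 2 * k then (1 : ℚ) / p else 0) + ∑ q ∈ s.erase p, (1 : ℚ) / q := by
    split_ifs with hd
    · refine (add_sum_erase s (fun q : ℕ ↦ (1 : ℚ) / q) ?_).symm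
      have := Nat.le_of_dvd (by lia) hd
      simp only [s, mem_filter, mem_range]
      exact ⟨by lia, hp, hd⟩
    · rw [erase_eq_of_notMem, zero_add]
      simp [s, hd]
  have : bernoulli (2 * k) + (if (p - 1) ∣ 2 * k then (1 : ℚ) / p else 0) =
      z - ∑ q ∈ s.erase p, (1 : ℚ) / q := by
    rw [hz, hsum]
    ring
  rw [this]
  exact sub_mem (intCast_mem _ _) hrest

lemma prime_mul_bernoulli_mem_pIntegers (k : ℕ) : (p : ℚ) * bernoulli k ∈ pIntegers p := by
  have hp : p.Prime := Fact.out
  have hp0 : (p : ℚ) ≠ 0 := mod_cast hp.ne_zero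
  rcases Nat.even_or_odd' k with ⟨m, rfl | rfl⟩
  · rcases Nat.eq_zero_or_pos m with rfl | hm
    · simp
    · have h := mul_mem (natCast_mem (pIntegers p) p)
        (bernoulli_add_indicator_mem_pIntegers (p := p) hm)
      rw [mul_add] at h
      refine (add_mem_cancel_right ?_).1 h
      split_ifs
      · rw [mul_one_div_cancel hp0]
        exact one_mem _
      · simp
  · rcases Nat.eq_zero_or_pos m with rfl | hm
    · rw [mul_zero, zero_add, bernoulli_one]
      rcases eq_or_ne p 2 with rfl | h2
      · norm_num
      · have := inv_intCast_mem_pIntegers (p := p) (u := 2) fun h ↦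
          h2 ((Nat.prime_dvd_prime_iff_eq hp Nat.prime_two).1 (mod_cast h))
        have h' := neg_mem (mul_mem (natCast_mem (pIntegers p) p) this)
        convert h' using 1
        push_cast
        ring
    · rw [bernoulli_eq_zero_of_odd ⟨m, rfl⟩ (by lia), mul_zero]
      exact zero_mem _

lemma not_dvd_num_bernoulli_div_of_sub_one_dvd {k : ℕ} (hk : 0 < k) (hd : (p - 1) ∣ 2 * k) :
    ¬ p ∣ (bernoulli (2 * k) / (2 * k : ℚ)).num.natAbs := by
  have hp : p.Prime := Fact.out
  intro h
  obtain ⟨y, hy, hxy⟩ := dvd_num_iff_exists_mem_pIntegers.1 h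
  have hB := bernoulli_add_indicator_mem_pIntegers (p := p) hk
  rw [if_pos hd] at hB
  have hk0 : (2 * k : ℚ) ≠ 0 := by positivity
  rw [div_eq_iff hk0] at hxy
  have hBmem : bernoulli (2 * k) ∈ pIntegers p := by
    rw [hxy]
    exact mul_mem (mul_mem (natCast_mem _ _) hy) (mod_cast natCast_mem (pIntegers p) (2 * k))
  have := (add_mem_cancel_left hBmem).1 hB
  rw [mem_pIntegers_iff] at this
  simp [hp.ne_zero] at this

open Finset in
/-- A power sum over a full range of residues modulo `p ^ r` is governed by a Bernoulli number. -/
lemma exists_sum_range_pow_eq_mul_bernoulli_add {r m : ℕ} (hp5 : 5 ≤ p) (hr : 1 ≤ r) (hm : 1 ≤ m)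
    (hme : Even m) :
    ∃ y ∈ pIntegers p, ∑ j ∈ range (p ^ r), (j : ℚ) ^ m =
      (p : ℚ) ^ r * bernoulli m + ((p : ℚ) ^ r) ^ 2 * y := by
  have hterm : ∀ i ∈ range m, ∃ y ∈ pIntegers p,
      bernoulli i * ((m + 1).choose i) * ((p ^ r : ℕ) : ℚ) ^ (m + 1 - i) / (m + 1) =
        ((p : ℚ) ^ r) ^ 2 * y := by
    intro i hi
    rw [mem_range] at hi
    obtain ⟨d, rfl⟩ := Nat.exists_eq_add_of_lt hi
    have hchoose : ((i + d + 1 + 1).choose i : ℚ) / ((i + d + 1 : ℕ) + 1) =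
        ((i + d + 1).choose i : ℚ) / ((d + 1 : ℕ) + 1) := by
      rw [div_eq_div_iff (by positivity) (by positivity)]
      have := Nat.choose_mul_succ_eq (i + d + 1) i
      rw [show i + d + 1 + 1 - i = d + 1 + 1 by lia] at this
      exact_mod_cast this.symm
    rw [mul_right_comm, mul_div_assoc, hchoose, show i + d + 1 + 1 - i = d + 2 by lia]
    rcases Nat.eq_zero_or_pos d with rfl | hd
    · rcases eq_or_ne i 1 with rfl | hi1
      · have h2 : (2 : ℚ)⁻¹ ∈ pIntegers p := by
          have := inv_intCast_mem_pIntegers (p := p) (u := 2) fun h ↦ by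
            have := Nat.le_of_dvd (by lia) (show p ∣ 2 from mod_cast h)
            lia
          simpa using this
        refine ⟨-2⁻¹, neg_mem h2, ?_⟩
        norm_num [bernoulli_one]
        ring
      · have hodd : Odd i := by grind
        have : 1 < i := by
          rcases hodd with ⟨k, rfl⟩
          lia
        exact ⟨0, zero_mem _, by rw [bernoulli_eq_zero_of_odd hodd this]; simp⟩
    · obtain ⟨s, hs⟩ : ∃ s, r * d = s + 1 :=
        ⟨r * d - 1, (Nat.sub_add_cancel (Nat.mul_pos hr hd)).symm⟩
      have hfac := factorization_succ_lt hp5 (show 2 ≤ d + 1 by lia)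
      have hle : d ≤ r * d := Nat.le_mul_of_pos_left d hr
      have hmem := pow_div_natCast_mem_pIntegers (p := p) (M := d + 1 + 1) (s := s)
        (by lia) (by lia)
      refine ⟨_, mul_mem (mul_mem (prime_mul_bernoulli_mem_pIntegers (p := p) i)
        (natCast_mem (pIntegers p) ((i + d + 1).choose i))) hmem, ?_⟩
      have hpow : ((p ^ r : ℕ) : ℚ) ^ (d + 2) = ((p : ℚ) ^ r) ^ 2 * (p ^ s * p) := by
        push_cast
        rw [pow_add, ← pow_succ, ← hs, pow_mul]
        ring
      rw [hpow]
      push_cast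
      ring
  choose! y hy hyeq using hterm
  refine ⟨∑ i ∈ range m, y i, sum_mem hy, ?_⟩
  rw [sum_range_pow, sum_range_succ, sum_congr rfl hyeq, ← mul_sum, Nat.choose_succ_self_right,
    Nat.add_sub_cancel_left]
  push_cast
  field_simp
  ring

open Finset in
/-- **Voronoi's congruence** modulo `p`. -/
lemma exists_voronoi_congruence {a r m : ℕ} (hp5 : 5 ≤ p) (ha : ¬ p ∣ a) (hm : 1 ≤ m)
    (hme : Even m) (hr : m < r) :
    ∃ y ∈ pIntegers p, ((a : ℚ) ^ m - 1) * (bernoulli m / m) =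
      (∑ j ∈ range (p ^ r), ((j * a / p ^ r : ℕ) * ((j * a : ℕ) : ℤ) ^ (m - 1)) : ℤ) + p * y := by
  have hp : p.Prime := Fact.out
  have hp0 : (p : ℚ) ≠ 0 := mod_cast hp.ne_zero
  have hN : 0 < p ^ r := pow_pos hp.pos r
  have hcop : (p ^ r).Coprime a := Nat.Coprime.pow_left r ((Nat.Prime.coprime_iff_not_dvd hp).2 ha)
  obtain ⟨z, hz⟩ := sq_dvd_sub_sum_pow_mul_floor hN hcop m
  obtain ⟨y, hy, hsum⟩ := exists_sum_range_pow_eq_mul_bernoulli_add (r := r) hp5 (by lia) hm hme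
  set T := ∑ j ∈ range (p ^ r), ((j * a / p ^ r : ℕ) * ((j * a : ℕ) : ℤ) ^ (m - 1))
  have hzq := congrArg (Int.cast : ℤ → ℚ) hz
  simp only [Int.cast_sub, Int.cast_mul, Int.cast_pow, Int.cast_natCast, Int.cast_one,
    Int.cast_sum, Nat.cast_pow] at hzq
  rw [hsum] at hzq
  have hm0 : (m : ℚ) ≠ 0 := by positivity
  have hmem := pow_div_natCast_mem_pIntegers (p := p) (M := m) (s := r - 1) (by lia)
    (by have := Nat.factorization_lt p (show m ≠ 0 by lia); lia)
  have hpr : (p : ℚ) ^ r = p ^ (r - 1) * p := by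
    rw [← pow_succ, Nat.sub_add_cancel (by lia)]
  refine ⟨_, mul_mem hmem (sub_mem (intCast_mem _ z)
    (mul_mem (sub_mem (pow_mem (natCast_mem _ a) m) (one_mem _)) hy)), ?_⟩
  have hpr0 : (p : ℚ) ^ r ≠ 0 := pow_ne_zero _ hp0
  have h1 : ((a : ℚ) ^ m - 1) * bernoulli m =
      m * T + (p : ℚ) ^ r * (z - ((a : ℚ) ^ m - 1) * y) := by
    apply mul_left_cancel₀ hpr0
    linear_combination hzq
  rw [← mul_div_assoc, h1, hpr]
  field_simp

lemma ZMod.pow_eq_pow_of_modEq_sub_one {m m' : ℕ} (hm : 1 ≤ m) (hm' : 1 ≤ m')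
    (h : m ≡ m' [MOD (p - 1)]) (x : ZMod p) : x ^ m = x ^ m' := by
  rcases eq_or_ne x 0 with rfl | hx
  · rw [zero_pow (by lia), zero_pow (by lia)]
  · exact pow_eq_pow_of_modEq h (ZMod.pow_card_sub_one_eq_one hx)

lemma exists_not_dvd_pow_sub_one {m : ℕ} (hm : ¬ (p - 1) ∣ m) :
    ∃ a : ℕ, ¬ p ∣ a ∧ ¬ (p : ℤ) ∣ (a : ℤ) ^ m - 1 := by
  obtain ⟨g, hg⟩ := IsCyclic.exists_generator (α := (ZMod p)ˣ)
  have hord : orderOf g = p - 1 := by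
    rw [orderOf_eq_card_of_forall_mem_zpowers hg, Nat.card_eq_fintype_card, ZMod.card_units]
  refine ⟨(g : ZMod p).val, ?_, ?_⟩
  · rw [← ZMod.natCast_eq_zero_iff, ZMod.natCast_zmod_val]
    exact g.ne_zero
  · rw [← ZMod.intCast_zmod_eq_zero_iff_dvd]
    push_cast
    rw [ZMod.natCast_zmod_val, sub_eq_zero]
    intro h
    exact hm (hord ▸ orderOf_dvd_of_pow_eq_one (Units.ext (by simpa using h)))

open Finset in
/-- The consequence of **Kummer's congruence** for divisibility by `p`. -/
lemma dvd_num_bernoulli_div_of_modEq {m m' : ℕ} (hp5 : 5 ≤ p) (hm : 2 ≤ m) (hm' : 2 ≤ m')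
    (hme : Even m) (hme' : Even m') (h : m ≡ m' [MOD (p - 1)]) (hdvd : ¬ (p - 1) ∣ m')
    (hB : p ∣ (bernoulli m / m).num.natAbs) : p ∣ (bernoulli m' / m').num.natAbs := by
  obtain ⟨a, ha, ha'⟩ := exists_not_dvd_pow_sub_one hdvd
  obtain ⟨y, hy, hyeq⟩ := exists_voronoi_congruence (r := m + m') hp5 ha (by lia) hme (by lia)
  obtain ⟨y', hy', hyeq'⟩ := exists_voronoi_congruence (r := m + m') hp5 ha (by lia) hme' (by lia)
  set T := ∑ j ∈ range (p ^ (m + m')),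
    ((j * a / p ^ (m + m') : ℕ) * ((j * a : ℕ) : ℤ) ^ (m - 1)) with hT
  set T' := ∑ j ∈ range (p ^ (m + m')),
    ((j * a / p ^ (m + m') : ℕ) * ((j * a : ℕ) : ℤ) ^ (m' - 1)) with hT'
  obtain ⟨b, hb, hbeq⟩ := dvd_num_iff_exists_mem_pIntegers.1 hB
  have hTdvd : (p : ℤ) ∣ T := by
    refine dvd_of_intCast_eq_mul (sub_mem (mul_mem (sub_mem (pow_mem (natCast_mem _ a) m)
      (one_mem _)) hb) hy) ?_
    rw [hbeq] at hyeq
    linear_combination -hyeq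
  have hTT' : (T : ZMod p) = T' := by
    rw [hT, hT']
    push_cast
    have hmod : m - 1 ≡ m' - 1 [MOD (p - 1)] := by
      refine Nat.ModEq.add_right_cancel' 1 ?_
      rwa [Nat.sub_add_cancel (by lia), Nat.sub_add_cancel (by lia)]
    exact sum_congr rfl fun j _ ↦ by
      rw [ZMod.pow_eq_pow_of_modEq_sub_one (by lia) (by lia) hmod]
  obtain ⟨c, hc⟩ : (p : ℤ) ∣ T' := by
    rw [← ZMod.intCast_zmod_eq_zero_iff_dvd] at hTdvd ⊢
    rw [← hTT', hTdvd]
  rw [hc] at hyeq'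
  have hu : ((a : ℚ) ^ m' - 1) ≠ 0 := by
    intro h0
    have : (a : ℤ) ^ m' - 1 = 0 := mod_cast h0
    simp [this] at ha'
  refine dvd_num_iff_exists_mem_pIntegers.2 ⟨_, mul_mem (inv_intCast_mem_pIntegers ha')
    (add_mem (intCast_mem _ c) hy'), ?_⟩
  push_cast at hyeq' ⊢
  rw [mul_left_comm, eq_inv_mul_iff_mul_eq₀ hu, hyeq']
  ring

end pIntegers

/-- If `p` is a Bernoulli regular prime (`p = 2`, `p = 3`, or `p ≥ 5` with
`p ∤ t(k)` for all `1 ≤ k ≤ (p-3)/2`, where `t(n)` is the absolute value of the numerator of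
`B_{2n}/(2n)`), then `p ∤ t(n)` for every `n ≥ 1`; in particular the `p`-part sequence of `t`
is constantly `1`. -/
theorem stmt_18 (p : ℕ) (hp : p.Prime)
    (hreg : p = 2 ∨ p = 3 ∨ (5 ≤ p ∧ ∀ k : ℕ, 1 ≤ k → k ≤ (p - 3) / 2 →
      ¬ p ∣ (bernoulli (2 * k) / (2 * k : ℚ)).num.natAbs))
    (n : ℕ) (hn : 1 ≤ n) :
    ¬ p ∣ (bernoulli (2 * n) / (2 * n : ℚ)).num.natAbs ∧
    p ^ padicValNat p ((bernoulli (2 * n) / (2 * n : ℚ)).num.natAbs) = 1 := by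
  have : Fact p.Prime := ⟨hp⟩
  suffices h : ¬ p ∣ (bernoulli (2 * n) / (2 * n : ℚ)).num.natAbs from
    ⟨h, by rw [padicValNat.eq_zero_of_not_dvd h, pow_zero]⟩
  by_cases hd : (p - 1) ∣ 2 * n
  · exact not_dvd_num_bernoulli_div_of_sub_one_dvd hn hd
  rcases hreg with rfl | rfl | ⟨hp5, hreg⟩
  · simp at hd
  · simp at hd
  intro hB
  obtain ⟨q, hq⟩ : Even (p - 1) := hp.even_sub_one (by lia)
  have hq2 : p - 1 = 2 * q := by lia
  have hmod : 2 * n % (p - 1) = 2 * (n % q) := by rw [hq2, Nat.mul_mod_mul_left]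
  have hd' : ¬ (p - 1) ∣ 2 * (n % q) := by rwa [← hmod, Nat.dvd_mod_iff dvd_rfl]
  have hk1 : 1 ≤ n % q := by
    by_contra! h0
    simp [Nat.lt_one_iff.1 h0] at hd'
  have hk2 : n % q < q := Nat.mod_lt n (by lia)
  refine hreg (n % q) hk1 (by lia) ?_
  have := dvd_num_bernoulli_div_of_modEq (p := p) (m := 2 * n) (m' := 2 * (n % q)) hp5 (by lia)
    (by lia) (even_two_mul _) (even_two_mul _) (by rw [← hmod]; exact (Nat.mod_modEq _ _).symm) hd'
    (by exact_mod_cast hB)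
  exact_mod_cast this
end

section
/- Let t(n) denote the absolute value of the numerator of the rational number B_{2n}/(2n) in lowest terms, and let p be a Bernoulli irregular prime, meaning there exists k with 1 ≤ k ≤ (p−3)/2 such that p divides t(k). Then the p-part sequence n ↦ p^{ν_p(t(n))} is not realizable: there is no set X and map T : X → X such that for every n ≥ 1 the set {x ∈ X : T^n(x) = x} is finite with exactly p^{ν_p(t(n))} elements. -/
theorem Bernoulli.prime_dvd_den_of_sub_one_dvd {k p : ℕ} (hk : 0 < k) (hp : p.Prime)
    (hdvd : (p - 1) ∣ 2 * k) : p ∣ (bernoulli (2 * k)).den := by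
  obtain ⟨z, hz⟩ := Bernoulli.vonStaudt_clausen k
  set S := (Finset.range (2 * k + 2)).filter fun q ↦ q.Prime ∧ (q - 1) ∣ 2 * k
  have hpS : p ∈ S := by
    have := Nat.le_of_dvd (by lia) hdvd
    exact Finset.mem_filter.mpr ⟨Finset.mem_range.mpr (by lia), hp, hdvd⟩
  rw [← Finset.add_sum_erase _ _ hpS] at hz
  set R := ∑ q ∈ S.erase p, (1 : ℚ) / q
  have hcop : p.Coprime R.den := by
    refine (Nat.Coprime.of_dvd_left (Finset.Rat.den_sum_dvd_prod_den _ _)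
      (Nat.Coprime.prod_left fun q hq ↦ ?_)).symm
    obtain ⟨hne, hq⟩ := Finset.mem_erase.mp hq
    have hq_prime : q.Prime := (Finset.mem_filter.mp hq).2.1
    rw [show ((1 : ℚ) / q).den = q by simp [hq_prime.ne_zero]]
    exact (Nat.coprime_primes hq_prime hp).mpr hne
  have hinv : (1 : ℚ) / p = z - (bernoulli (2 * k) + R) := by linarith
  have hden : p ∣ ((z : ℚ) - (bernoulli (2 * k) + R)).den := by
    rw [← hinv]
    simp [hp.ne_zero]
  have h := (hden.trans (Rat.sub_den_dvd _ _)).trans (mul_dvd_mul_left _ (Rat.add_den_dvd _ _))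
  rw [Rat.den_intCast, one_mul] at h
  exact hcop.dvd_of_dvd_mul_right h

theorem bernoulli_two_mul_ne_zero {k : ℕ} (hk : 0 < k) : bernoulli (2 * k) ≠ 0 := by
  intro h
  have := Bernoulli.prime_dvd_den_of_sub_one_dvd hk Nat.prime_two (by simp)
  simp [h] at this

theorem Rat.not_dvd_num_of_dvd_den {p : ℕ} (hp : p.Prime) {q : ℚ} (h : p ∣ q.den) :
    ¬ p ∣ q.num.natAbs := fun hn ↦
  hp.one_lt.ne' (Nat.dvd_one.mp (q.reduced ▸ Nat.dvd_gcd hn h))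

theorem Rat.den_dvd_den_div_natCast (q : ℚ) {m : ℕ} (hm : m ≠ 0) : q.den ∣ (q / m).den := by
  have h := Rat.mul_den_dvd (q / m) m
  rwa [div_mul_cancel₀ _ (Nat.cast_ne_zero.mpr hm), Rat.den_natCast, mul_one] at h

/-- If `p` is a Bernoulli irregular prime (`p ∣ t(k)` for some
`1 ≤ k ≤ (p-3)/2`, where `t(n)` is the absolute value of the numerator of `B_{2n}/(2n)`),
then the `p`-part sequence `n ↦ p^(ν_p(t(n)))` is not realizable by any map. -/
theorem stmt_19 (p : ℕ) (hp : p.Prime)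
    (hirr : ∃ k : ℕ, 1 ≤ k ∧ k ≤ (p - 3) / 2 ∧
      p ∣ (bernoulli (2 * k) / (2 * k : ℚ)).num.natAbs) :
    ¬ ∃ (X : Type) (T : X → X),
      ∀ n : ℕ, 1 ≤ n → {x : X | T^[n] x = x}.Finite ∧
        {x : X | T^[n] x = x}.ncard =
          p ^ padicValNat p ((bernoulli (2 * n) / (2 * n : ℚ)).num.natAbs) := by
  rintro ⟨X, T, hT⟩
  obtain ⟨k, hk, hkp, hdvd⟩ := hirr
  have hp2 : 0 < p - 1 := by lia
  have hn : 0 < k * (p - 1) := Nat.mul_pos hk hp2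
  have hle : {x : X | T^[k] x = x}.ncard ≤ {x : X | T^[k * (p - 1)] x = x}.ncard := by
    refine Set.ncard_le_ncard (fun x hx ↦ ?_) (hT _ hn).1
    have hx : Function.IsPeriodicPt T k x := hx
    exact hx.mul_const (p - 1)
  have hden : p ∣ (bernoulli (2 * (k * (p - 1))) / (2 * (k * (p - 1) : ℕ) : ℚ)).den := by
    have h := Rat.den_dvd_den_div_natCast (bernoulli (2 * (k * (p - 1))))
      (m := 2 * (k * (p - 1))) (by lia)
    rw [Nat.cast_mul 2, Nat.cast_two] at h
    exact (Bernoulli.prime_dvd_den_of_sub_one_dvd hn hp ⟨2 * k, by ring⟩).trans h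
  rw [(hT k hk).2, (hT _ hn).2,
    padicValNat.eq_zero_of_not_dvd (Rat.not_dvd_num_of_dvd_den hp hden), pow_zero] at hle
  have hne : (bernoulli (2 * k) / (2 * k : ℚ)).num.natAbs ≠ 0 := by
    have hk0 : (k : ℚ) ≠ 0 := Nat.cast_ne_zero.mpr (by lia)
    simp [bernoulli_two_mul_ne_zero hk, hk0]
  have : Fact p.Prime := ⟨hp⟩
  have hval := one_le_padicValNat_of_dvd hne hdvd
  exact absurd hle (Nat.one_lt_pow (by lia) hp.one_lt).not_ge
end
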